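/- arXiv:cond-mat/0703014 — 2 statements merged into one kernel-verified Lean document; each statement's English description precedes it below -/
import Mathlib

section
/- For every even positive integer L, the number of equivalence classes of non-crossing partitions of {1,…,L} under the reflection τ(i) = L+1−i (where two non-crossing partitions P, P' are equivalent iff P' = τ·P or P' = P) equals (1/2)·[C_L + binom(L, L/2)]. (This is the count N_{Z,hc,FF,L_y} for even width L_y, Theorem 1 of the paper, even case.) -/
open Finset

/-- A partition `P` of `{1,…,L}` (modeled as `Fin L`) is non-crossing if there are no
indices `a < b < c < d` with `a, c` in one block of `P` and `b, d` in a different block. -/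
def NonCrossing {L : ℕ} (P : Finpartition (Finset.univ : Finset (Fin L))) : Prop :=
  ¬ ∃ a b c d : Fin L, a < b ∧ b < c ∧ c < d ∧
      ∃ B₁ ∈ P.parts, ∃ B₂ ∈ P.parts, B₁ ≠ B₂ ∧ a ∈ B₁ ∧ c ∈ B₁ ∧ b ∈ B₂ ∧ d ∈ B₂

/-- The set of parts of the image of a partition under the reflection
`τ(i) = L+1−i` (on `Fin L`, `i ↦ L-1-i`, i.e. `Fin.rev`). -/
def reflParts {L : ℕ} (P : Finpartition (Finset.univ : Finset (Fin L))) :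
    Finset (Finset (Fin L)) :=
  P.parts.image (fun B => B.image Fin.rev)

/-- The set of equivalence classes of non-crossing partitions of `{1,…,L}` under the
reflection `τ(i) = L+1−i`, where `P ≈ P'` iff `P' = τ·P` or `P' = P`: each class is
identified with the unordered pair `{P.parts, (τ·P).parts}`. -/
def reflClasses (L : ℕ) : Set (Set (Finset (Finset (Fin L)))) :=
  (fun P : Finpartition (Finset.univ : Finset (Fin L)) =>
      ({P.parts, reflParts P} : Set (Finset (Finset (Fin L))))) '' {P | NonCrossing P}

/-! ### Lattice words

A word in up-steps and down-steps is encoded by the finite set of positions of its down-steps. -/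

/-- The height reached after `t` steps by the word with down-steps at the positions in `D`. -/
def height (D : Finset ℕ) (t : ℕ) : ℤ := t - 2 * #{s ∈ D | s < t}

@[simp] lemma height_zero (D : Finset ℕ) : height D 0 = 0 := by simp [height]

lemma height_succ_of_mem {D : Finset ℕ} {t : ℕ} (h : t ∈ D) :
    height D (t + 1) = height D t - 1 := by
  have : {s ∈ D | s < t + 1} = insert t {s ∈ D | s < t} := by grind
  simp only [height, this]
  rw [card_insert_of_notMem (by simp)]
  push_cast
  ring

lemma height_succ_of_notMem {D : Finset ℕ} {t : ℕ} (h : t ∉ D) :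
    height D (t + 1) = height D t + 1 := by
  have : {s ∈ D | s < t + 1} = {s ∈ D | s < t} := by grind
  simp only [height, this]
  push_cast
  ring

lemma height_congr {D E : Finset ℕ} {t : ℕ} (h : ∀ s < t, s ∈ D ↔ s ∈ E) :
    height D t = height E t := by
  have : {s ∈ D | s < t} = {s ∈ E | s < t} := by grind
  simp only [height, this]

lemma height_eq_of_subset_range {D : Finset ℕ} {n : ℕ} (h : D ⊆ range n) :
    height D n = n - 2 * #D := by
  have : {s ∈ D | s < n} = D := by grind
  simp only [height, this]

lemma height_emod_two (D : Finset ℕ) (t : ℕ) : height D t % 2 = t % 2 := by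
  simp only [height]
  omega

/-- Words of length `n` that never go below height `0` and have at most `m` down-steps. -/
def ballotWords (n m : ℕ) : Finset (Finset ℕ) :=
  {D ∈ (range n).powerset | #D ≤ m ∧ ∀ k ≤ n, 0 ≤ height D k}

lemma mem_ballotWords {n m : ℕ} {D : Finset ℕ} :
    D ∈ ballotWords n m ↔ D ⊆ range n ∧ #D ≤ m ∧ ∀ k ≤ n, 0 ≤ height D k := by
  simp [ballotWords]

lemma two_mul_card_le_of_mem_ballotWords {n m : ℕ} {D : Finset ℕ} (h : D ∈ ballotWords n m) :
    2 * #D ≤ n := by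
  obtain ⟨h₁, -, h₃⟩ := mem_ballotWords.1 h
  have := h₃ n le_rfl
  rw [height_eq_of_subset_range h₁] at this
  omega

lemma ballotWords_zero_right (n : ℕ) : ballotWords n 0 = {∅} := by
  ext D
  simp only [mem_ballotWords, mem_singleton, nonpos_iff_eq_zero, card_eq_zero]
  refine ⟨fun h => h.2.1, ?_⟩
  rintro rfl
  simp [height]

lemma card_ballotWords_succ_succ {n m : ℕ} (h : 2 * (m + 1) ≤ n + 1) :
    #(ballotWords (n + 1) (m + 1)) = #(ballotWords n (m + 1)) + #(ballotWords n m) := by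
  have e₁ : {D ∈ ballotWords (n + 1) (m + 1) | n ∉ D} = ballotWords n (m + 1) := by
    ext D
    simp only [mem_filter, mem_ballotWords]
    constructor
    · rintro ⟨⟨h₁, h₂, h₃⟩, h₄⟩
      refine ⟨fun x hx => ?_, h₂, fun k hk => h₃ k (by omega)⟩
      have := h₁ hx
      grind
    · rintro ⟨h₁, h₂, h₃⟩
      have hn : n ∉ D := fun hx => by simpa using h₁ hx
      refine ⟨⟨h₁.trans (by simp), h₂, fun k hk => ?_⟩, hn⟩
      rcases Nat.le_succ_iff.1 hk with hk | rfl
      · exact h₃ k hk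
      · rw [height_succ_of_notMem hn]
        have := h₃ n le_rfl
        omega
  have e₂ : {D ∈ ballotWords (n + 1) (m + 1) | ¬ n ∉ D} = (ballotWords n m).image (insert n) := by
    ext D
    simp only [mem_filter, mem_ballotWords, mem_image, not_not]
    constructor
    · rintro ⟨⟨h₁, h₂, h₃⟩, h₄⟩
      refine ⟨D.erase n, ⟨fun x hx => ?_, ?_, fun k hk => ?_⟩, insert_erase h₄⟩
      · have := h₁ (mem_of_mem_erase hx)
        grind
      · rw [card_erase_of_mem h₄]
        omega
      · rw [height_congr (E := D) (by grind)]
        exact h₃ k (by omega)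
    · rintro ⟨E, ⟨h₁, h₂, h₃⟩, rfl⟩
      have hn : n ∉ E := fun hx => by simpa using h₁ hx
      have hs : insert n E ⊆ range (n + 1) := by
        rw [range_add_one]
        exact insert_subset_insert n h₁
      have hc : #(insert n E) = #E + 1 := card_insert_of_notMem hn
      refine ⟨⟨hs, by omega, fun k hk => ?_⟩, mem_insert_self _ _⟩
      rcases Nat.le_succ_iff.1 hk with hk | rfl
      · rw [height_congr (E := E) (by grind)]
        exact h₃ k hk
      · rw [height_eq_of_subset_range hs, hc]
        push_cast
        omega
  rw [← card_filter_add_card_filter_not (s := ballotWords (n + 1) (m + 1)) (fun D => n ∉ D), e₁, e₂,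
    card_image_of_injOn]
  intro D hD E hE hDE
  have hD' := (mem_ballotWords.1 hD).1
  have hE' := (mem_ballotWords.1 hE).1
  rw [← erase_insert (a := n) (s := D), ← erase_insert (a := n) (s := E)]
  · exact congrArg (fun F => erase F n) hDE
  · exact fun hx => by simpa using hE' hx
  · exact fun hx => by simpa using hD' hx

/-- The ballot theorem, in cumulative form. -/
theorem card_ballotWords (n m : ℕ) (h : 2 * m ≤ n + 1) : #(ballotWords n m) = n.choose m := by
  induction n generalizing m with
  | zero =>
    obtain rfl : m = 0 := by omega
    simp [ballotWords_zero_right]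
  | succ n ih =>
    have key : ∀ m, 2 * m ≤ n + 1 → #(ballotWords (n + 1) m) = (n + 1).choose m := by
      rintro (_ | m) hm
      · simp [ballotWords_zero_right]
      · rw [card_ballotWords_succ_succ hm, ih _ hm, ih m (by omega), Nat.choose_succ_succ, add_comm]
    rcases Nat.lt_or_ge (n + 1) (2 * m) with hm | hm
    · obtain ⟨k, rfl⟩ : ∃ k, m = k + 1 := ⟨m - 1, by omega⟩
      have e : ballotWords (n + 1) (k + 1) = ballotWords (n + 1) k := by
        ext D
        constructor <;> intro hD <;> have hc := two_mul_card_le_of_mem_ballotWords hD <;>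
          simp only [mem_ballotWords] at hD ⊢ <;> exact ⟨hD.1, by omega, hD.2.2⟩
      rw [e, key k (by omega)]
      exact Nat.choose_symm_of_eq_add (by omega)
    · exact key m hm

/-- Words of length `2 * L` that start and end at height `0` and never go below it. -/
def dyckWords (L : ℕ) : Finset (Finset ℕ) :=
  {D ∈ (range (2 * L)).powerset | (∀ k ≤ 2 * L, 0 ≤ height D k) ∧ height D (2 * L) = 0}

lemma mem_dyckWords {L : ℕ} {D : Finset ℕ} : D ∈ dyckWords L ↔
    D ⊆ range (2 * L) ∧ (∀ k ≤ 2 * L, 0 ≤ height D k) ∧ height D (2 * L) = 0 := by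
  simp [dyckWords]

theorem card_dyckWords {L : ℕ} (hL : 0 < L) :
    #(dyckWords L) + (2 * L).choose (L - 1) = (2 * L).choose L := by
  rw [← card_ballotWords (2 * L) L (by omega), ← card_ballotWords (2 * L) (L - 1) (by omega)]
  rw [← card_union_of_disjoint]
  · congr 1
    ext D
    simp only [mem_union, mem_dyckWords, mem_ballotWords]
    constructor
    · rintro (⟨h₁, h₂, h₃⟩ | ⟨h₁, h₂, h₃⟩)
      · rw [height_eq_of_subset_range h₁] at h₃
        exact ⟨h₁, by omega, h₂⟩
      · exact ⟨h₁, by omega, h₃⟩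
    · rintro ⟨h₁, h₂, h₃⟩
      rw [height_eq_of_subset_range h₁]
      rcases Nat.lt_or_ge #D L with h | h
      · exact Or.inr ⟨h₁, by omega, h₃⟩
      · exact Or.inl ⟨h₁, h₃, by push_cast; omega⟩
  · rw [disjoint_left]
    intro D hD hD'
    obtain ⟨h₁, -, h₃⟩ := mem_dyckWords.1 hD
    obtain ⟨-, h₂, -⟩ := mem_ballotWords.1 hD'
    rw [height_eq_of_subset_range h₁] at h₃
    push_cast at h₃
    omega

/-- The word of length `2 * L` read backwards, with up-steps and down-steps exchanged. -/
def revWord (L : ℕ) (D : Finset ℕ) : Finset ℕ := {t ∈ range (2 * L) | 2 * L - 1 - t ∉ D}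

lemma mem_revWord {L t : ℕ} {D : Finset ℕ} :
    t ∈ revWord L D ↔ t < 2 * L ∧ 2 * L - 1 - t ∉ D := by
  simp [revWord]

lemma height_add_of_revWord_eq {L : ℕ} {D : Finset ℕ} (h : revWord L D = D) {s : ℕ} (hs : s ≤ L) :
    height D (L + s) = height D (L - s) := by
  induction s with
  | zero => simp
  | succ s ih =>
    have ih := ih (by omega)
    have e : L - s = L - (s + 1) + 1 := by omega
    have hm : L + s ∈ D ↔ L - (s + 1) ∉ D := by
      nth_rw 1 [← h]
      rw [mem_revWord, show 2 * L - 1 - (L + s) = L - (s + 1) by omega]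
      exact and_iff_right (by omega)
    rw [e] at ih
    rw [← add_assoc]
    by_cases hD : L + s ∈ D
    · rw [height_succ_of_notMem (hm.1 hD)] at ih
      rw [height_succ_of_mem hD, ih]
      ring
    · rw [height_succ_of_mem (not_not.1 (mt hm.2 hD))] at ih
      rw [height_succ_of_notMem hD, ih]
      ring

theorem card_filter_revWord_eq (L : ℕ) :
    #{D ∈ dyckWords L | revWord L D = D} = L.choose (L / 2) := by
  rw [← card_ballotWords L (L / 2) (by omega)]
  refine card_nbij' (fun D => {t ∈ D | t < L})
    (fun E => E ∪ {t ∈ range (2 * L) | L ≤ t ∧ 2 * L - 1 - t ∉ E}) ?_ ?_ ?_ ?_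
  · intro D hD
    simp only [coe_filter, Set.mem_ofPred_eq, mem_dyckWords] at hD
    obtain ⟨⟨h₁, h₂, h₃⟩, h₄⟩ := hD
    have hs : {t ∈ D | t < L} ⊆ range L := fun t ht => by simpa using (mem_filter.1 ht).2
    have hh : ∀ k ≤ L, 0 ≤ height {t ∈ D | t < L} k := by
      intro k hk
      rw [height_congr (E := D) (by grind)]
      exact h₂ k (by omega)
    refine mem_ballotWords.2 ⟨hs, ?_, hh⟩
    have := hh L le_rfl
    rw [height_eq_of_subset_range hs] at this
    change #{t ∈ D | t < L} ≤ L / 2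
    omega
  · intro E hE
    obtain ⟨h₁, -, h₃⟩ := mem_ballotWords.1 hE
    have h₁' : ∀ t ∈ E, t < L := fun t ht => by simpa using h₁ ht
    set D := E ∪ {t ∈ range (2 * L) | L ≤ t ∧ 2 * L - 1 - t ∉ E} with hD
    have hrev : revWord L D = D := by
      ext t
      simp only [mem_revWord, hD, mem_union, mem_filter, mem_range]
      have := h₁' t
      have := h₁' (2 * L - 1 - t)
      rcases Nat.lt_or_ge t L with ht | ht
      · have e : 2 * L - 1 - (2 * L - 1 - t) = t := by omega
        rw [e]
        grind
      · grind
    have hlow : ∀ k ≤ L, 0 ≤ height D k := by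
      intro k hk
      rw [height_congr (E := E) (by grind)]
      exact h₃ k hk
    simp only [coe_filter, Set.mem_ofPred_eq, mem_dyckWords]
    refine ⟨⟨?_, fun k hk => ?_, ?_⟩, hrev⟩
    · intro t ht
      have := h₁' t
      simp only [mem_union, mem_filter, mem_range] at ht ⊢
      grind
    · rcases Nat.lt_or_ge k L with h | h
      · exact hlow k h.le
      · obtain ⟨s, rfl⟩ := Nat.exists_eq_add_of_le h
        rw [height_add_of_revWord_eq hrev (by omega)]
        exact hlow _ (by omega)
    · have := height_add_of_revWord_eq hrev le_rfl
      rwa [← two_mul, Nat.sub_self, height_zero] at this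
  · intro D hD
    simp only [coe_filter, Set.mem_ofPred_eq, mem_dyckWords] at hD
    obtain ⟨⟨h₁, -, -⟩, h₄⟩ := hD
    ext t
    have h₅ : t ∈ D ↔ t < 2 * L ∧ 2 * L - 1 - t ∉ D := by
      rw [← mem_revWord, h₄]
    simp only [mem_union, mem_filter, mem_range]
    grind
  · intro E hE
    have h₁ := (mem_ballotWords.1 hE).1
    ext t
    have : t ∈ E → t < L := fun ht => by simpa using h₁ ht
    simp only [mem_union, mem_filter, mem_range]
    grind

/-! ### Non-crossing partitions and Dyck words -/

lemma Finpartition.eq_of_mem_part_iff {α : Type*} [DecidableEq α] {s : Finset α}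
    {P Q : Finpartition s} (h : ∀ i j, j ∈ P.part i ↔ j ∈ Q.part i) : P = Q := by
  have hp : ∀ i, P.part i = Q.part i := fun i => by ext j; exact h i j
  ext B
  constructor <;> intro hB
  · obtain ⟨i, hi⟩ := P.nonempty_of_mem_parts hB
    rw [← P.part_eq_of_mem hB hi, hp]
    exact Q.part_mem.2 (P.le hB hi)
  · obtain ⟨i, hi⟩ := Q.nonempty_of_mem_parts hB
    rw [← Q.part_eq_of_mem hB hi, ← hp]
    exact P.part_mem.2 (Q.le hB hi)

section

variable {L : ℕ}

lemma mem_part_symm {P : Finpartition (univ : Finset (Fin L))} {i j : Fin L}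
    (h : j ∈ P.part i) : i ∈ P.part j := by
  rw [P.mem_part_iff_part_eq_part (mem_univ _) (mem_univ _)] at h ⊢
  exact h.symm

lemma mem_part_trans {P : Finpartition (univ : Finset (Fin L))} {i j k : Fin L}
    (h : j ∈ P.part i) (h' : k ∈ P.part j) : k ∈ P.part i := by
  rw [P.mem_part_iff_part_eq_part (mem_univ _) (mem_univ _)] at h h' ⊢
  exact h'.trans h

lemma nonCrossing_iff {P : Finpartition (univ : Finset (Fin L))} :
    NonCrossing P ↔ ∀ a b c d : Fin L, a < b → b < c → c < d →
      c ∈ P.part a → d ∈ P.part b → b ∈ P.part a := by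
  constructor
  · intro h a b c d hab hbc hcd hac hbd
    by_contra hne
    refine h ⟨a, b, c, d, hab, hbc, hcd, P.part a, P.part_mem.2 (mem_univ _), P.part b,
      P.part_mem.2 (mem_univ _), ?_, P.mem_part (mem_univ _), hac, P.mem_part (mem_univ _), hbd⟩
    intro he
    exact hne (he ▸ P.mem_part (mem_univ _))
  · rintro h ⟨a, b, c, d, hab, hbc, hcd, B₁, hB₁, B₂, hB₂, hne, ha, hc, hb, hd⟩
    have e₁ := P.part_eq_of_mem hB₁ ha
    have e₂ := P.part_eq_of_mem hB₂ hb
    have := h a b c d hab hbc hcd (e₁ ▸ hc) (e₂ ▸ hd)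
    rw [e₁] at this
    exact hne (P.eq_of_mem_parts hB₁ hB₂ this hb)

open Classical in
/-- The word in which the `i`-th element of `Fin L` contributes two steps: the first one is down
iff `i` is not the least element of its block, the second one iff `i` is the greatest. -/
noncomputable def wordOf (P : Finpartition (univ : Finset (Fin L))) : Finset ℕ :=
  {t ∈ range (2 * L) | ∃ i : Fin L, (t = 2 * i ∧ ∃ j ∈ P.part i, j < i) ∨
    (t = 2 * i + 1 ∧ ∀ j ∈ P.part i, j ≤ i)}

lemma two_mul_mem_wordOf {P : Finpartition (univ : Finset (Fin L))} {i : Fin L} :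
    2 * (i : ℕ) ∈ wordOf P ↔ ∃ j ∈ P.part i, j < i := by
  simp only [wordOf, mem_filter, mem_range]
  constructor
  · rintro ⟨-, k, ⟨h, h'⟩ | ⟨h, -⟩⟩
    · obtain rfl : i = k := by ext; omega
      exact h'
    · omega
  · exact fun h => ⟨by omega, i, Or.inl ⟨rfl, h⟩⟩

lemma two_mul_add_one_mem_wordOf {P : Finpartition (univ : Finset (Fin L))} {i : Fin L} :
    2 * (i : ℕ) + 1 ∈ wordOf P ↔ ∀ j ∈ P.part i, j ≤ i := by
  simp only [wordOf, mem_filter, mem_range]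
  constructor
  · rintro ⟨-, k, ⟨h, -⟩ | ⟨h, h'⟩⟩
    · omega
    · obtain rfl : i = k := by ext; omega
      exact h'
  · exact fun h => ⟨by omega, i, Or.inr ⟨rfl, h⟩⟩

lemma wordOf_subset (P : Finpartition (univ : Finset (Fin L))) : wordOf P ⊆ range (2 * L) :=
  filter_subset _ _

lemma finset_ext_of_two_mul {D E : Finset ℕ} (hD : D ⊆ range (2 * L)) (hE : E ⊆ range (2 * L))
    (h₀ : ∀ i : Fin L, 2 * (i : ℕ) ∈ D ↔ 2 * (i : ℕ) ∈ E)
    (h₁ : ∀ i : Fin L, 2 * (i : ℕ) + 1 ∈ D ↔ 2 * (i : ℕ) + 1 ∈ E) : D = E := by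
  ext t
  by_cases ht : t < 2 * L
  · obtain ⟨k, rfl | rfl⟩ := Nat.even_or_odd' t
    · exact h₀ ⟨k, by omega⟩
    · exact h₁ ⟨k, by omega⟩
  · have hD' : t ∉ D := fun h => ht (mem_range.1 (hD h))
    have hE' : t ∉ E := fun h => ht (mem_range.1 (hE h))
    simp [hD', hE']

open Classical in
/-- The blocks of `P` that contain an element `< s` and an element `≥ t`. -/
noncomputable def straddling (P : Finpartition (univ : Finset (Fin L))) (s t : ℕ) :
    Finset (Finset (Fin L)) :=
  {B ∈ P.parts | (∃ x ∈ B, (x : ℕ) < s) ∧ ∃ y ∈ B, t ≤ (y : ℕ)}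

lemma mem_straddling {P : Finpartition (univ : Finset (Fin L))} {s t : ℕ} {B : Finset (Fin L)} :
    B ∈ straddling P s t ↔ B ∈ P.parts ∧ (∃ x ∈ B, (x : ℕ) < s) ∧ ∃ y ∈ B, t ≤ (y : ℕ) := by
  simp [straddling]

lemma height_wordOf_odd_of_even {P : Finpartition (univ : Finset (Fin L))} (i : Fin L)
    (h : height (wordOf P) (2 * i) = 2 * #(straddling P i i)) :
    height (wordOf P) (2 * i + 1) = 2 * #(straddling P (i + 1) i) - 1 := by
  have hins : straddling P (i + 1) i = insert (P.part i) (straddling P i i) := by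
    ext B
    simp only [mem_insert, mem_straddling]
    constructor
    · rintro ⟨hB, ⟨x, hx, hxi⟩, hy⟩
      rcases Nat.lt_succ_iff_lt_or_eq.1 hxi with hxi | hxi
      · exact Or.inr ⟨hB, ⟨x, hx, hxi⟩, hy⟩
      · obtain rfl : x = i := Fin.ext hxi
        exact Or.inl (P.part_eq_of_mem hB hx).symm
    · rintro (rfl | ⟨hB, ⟨x, hx, hxi⟩, hy⟩)
      · exact ⟨P.part_mem.2 (mem_univ _), ⟨i, P.mem_part (mem_univ _), by omega⟩,
          i, P.mem_part (mem_univ _), le_rfl⟩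
      · exact ⟨hB, ⟨x, hx, by omega⟩, hy⟩
  have hmem : P.part i ∈ straddling P i i ↔ 2 * (i : ℕ) ∈ wordOf P := by
    rw [mem_straddling, two_mul_mem_wordOf]
    exact ⟨fun h => h.2.1, fun h => ⟨P.part_mem.2 (mem_univ _), h,
      i, P.mem_part (mem_univ _), le_rfl⟩⟩
  by_cases hi : 2 * (i : ℕ) ∈ wordOf P
  · rw [height_succ_of_mem hi, h, hins, insert_eq_of_mem (hmem.2 hi)]
  · rw [height_succ_of_notMem hi, h, hins, card_insert_of_notMem (mt hmem.1 hi)]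
    push_cast
    ring

lemma height_wordOf_even_of_odd {P : Finpartition (univ : Finset (Fin L))} (i : Fin L)
    (h : height (wordOf P) (2 * i + 1) = 2 * #(straddling P (i + 1) i) - 1) :
    height (wordOf P) (2 * (i + 1)) = 2 * #(straddling P (i + 1) (i + 1)) := by
  have hpart : P.part i ∈ straddling P (i + 1) i :=
    mem_straddling.2 ⟨P.part_mem.2 (mem_univ _), ⟨i, P.mem_part (mem_univ _), by omega⟩,
      i, P.mem_part (mem_univ _), le_rfl⟩
  have hsub : ∀ B, B ≠ P.part i → (B ∈ straddling P (i + 1) (i + 1) ↔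
      B ∈ straddling P (i + 1) i) := by
    intro B hne
    simp only [mem_straddling]
    refine and_congr_right fun hB => and_congr_right fun _ => ?_
    constructor
    · rintro ⟨y, hy, hiy⟩
      exact ⟨y, hy, by omega⟩
    · rintro ⟨y, hy, hiy⟩
      refine ⟨y, hy, ?_⟩
      by_contra hlt
      obtain rfl : y = i := by ext; omega
      exact hne (P.part_eq_of_mem hB hy).symm
  have hmem : P.part i ∈ straddling P (i + 1) (i + 1) ↔ 2 * (i : ℕ) + 1 ∉ wordOf P := by
    rw [mem_straddling, two_mul_add_one_mem_wordOf]
    push Not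
    refine ⟨fun h => h.2.2, fun h => ⟨P.part_mem.2 (mem_univ _), ?_, h⟩⟩
    exact ⟨i, P.mem_part (mem_univ _), by omega⟩
  rw [show 2 * ((i : ℕ) + 1) = 2 * i + 1 + 1 by ring]
  by_cases hi : 2 * (i : ℕ) + 1 ∈ wordOf P
  · have e : straddling P (i + 1) (i + 1) = (straddling P (i + 1) i).erase (P.part i) := by
      ext B
      grind
    have := card_pos.2 ⟨_, hpart⟩
    rw [height_succ_of_mem hi, h, e, card_erase_of_mem hpart]
    omega
  · have e : straddling P (i + 1) (i + 1) = straddling P (i + 1) i := by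
      ext B
      grind
    rw [height_succ_of_notMem hi, h, e]
    ring

lemma height_wordOf_two_mul (P : Finpartition (univ : Finset (Fin L))) {i : ℕ} (hi : i ≤ L) :
    height (wordOf P) (2 * i) = 2 * #(straddling P i i) := by
  induction i with
  | zero => simp [straddling]
  | succ i ih =>
    have hi' : i < L := by omega
    exact height_wordOf_even_of_odd ⟨i, hi'⟩ (height_wordOf_odd_of_even ⟨i, hi'⟩ (ih hi'.le))

lemma height_wordOf_two_mul_add_one (P : Finpartition (univ : Finset (Fin L))) (i : Fin L) :
    height (wordOf P) (2 * i + 1) = 2 * #(straddling P (i + 1) i) - 1 :=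
  height_wordOf_odd_of_even i (height_wordOf_two_mul P i.2.le)

lemma wordOf_mem_dyckWords (P : Finpartition (univ : Finset (Fin L))) :
    wordOf P ∈ dyckWords L := by
  refine mem_dyckWords.2 ⟨wordOf_subset P, fun k hk => ?_, ?_⟩
  · rcases Nat.even_or_odd' k with ⟨i, rfl | rfl⟩
    · rw [height_wordOf_two_mul P (by omega)]
      positivity
    · have hi : i < L := by omega
      have hpos : 0 < #(straddling P (i + 1) i) :=
        card_pos.2 ⟨P.part ⟨i, hi⟩, mem_straddling.2 ⟨P.part_mem.2 (mem_univ _),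
          ⟨⟨i, hi⟩, P.mem_part (mem_univ _), by simp⟩,
          ⟨⟨i, hi⟩, P.mem_part (mem_univ _), by simp⟩⟩⟩
      have := height_wordOf_two_mul_add_one P ⟨i, hi⟩
      simp only at this
      omega
  · rw [height_wordOf_two_mul P le_rfl]
    have : straddling P L L = ∅ := by
      ext B
      simp only [mem_straddling, notMem_empty, iff_false]
      rintro ⟨-, -, y, -, hy⟩
      omega
    simp [this]

lemma straddling_eq_of_mem_part {P : Finpartition (univ : Finset (Fin L))} (hP : NonCrossing P)
    {i j : Fin L} (hij : i < j) (h : j ∈ P.part i) :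
    straddling P (i + 1) i = straddling P (j + 1) j := by
  have hP := nonCrossing_iff.1 hP
  have hcases : ∀ {B}, B ∈ P.parts → B ≠ P.part i → i ∉ B ∧ j ∉ B := by
    intro B hB hne
    exact ⟨fun hi => hne (P.part_eq_of_mem hB hi).symm,
      fun hj => hne (P.eq_of_mem_parts hB (P.part_mem.2 (mem_univ _)) hj h)⟩
  have hpart : ∀ {B}, B ∈ P.parts → ∀ {x y}, x ∈ B → y ∈ B → y ∈ P.part x :=
    fun hB _ _ hx hy => P.part_eq_of_mem hB hx ▸ hy
  ext B
  by_cases hBi : B = P.part i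
  · subst hBi
    simp only [mem_straddling]
    have := P.mem_part (mem_univ i)
    exact ⟨fun h' => ⟨h'.1, ⟨j, h, by omega⟩, j, h, le_rfl⟩,
      fun h' => ⟨h'.1, ⟨i, this, by omega⟩, i, this, le_rfl⟩⟩
  simp only [mem_straddling]
  refine and_congr_right fun hB => ?_
  obtain ⟨hiB, hjB⟩ := hcases hB hBi
  have hnei : ∀ x ∈ B, x ≠ i := fun x hx he => hiB (he ▸ hx)
  have hnej : ∀ x ∈ B, x ≠ j := fun x hx he => hjB (he ▸ hx)
  constructor
  · rintro ⟨⟨x, hx, hxi⟩, y, hy, hiy⟩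
    have := hnei x hx
    have := hnei y hy
    refine ⟨⟨x, hx, by omega⟩, y, hy, ?_⟩
    by_contra hlt
    have := hP x i y j (by omega) (by omega) (by omega) (hpart hB hx hy) h
    rw [P.part_eq_of_mem hB hx] at this
    exact hiB this
  · rintro ⟨⟨x, hx, hxj⟩, y, hy, hjy⟩
    have := hnej x hx
    have := hnej y hy
    refine ⟨⟨x, hx, ?_⟩, y, hy, by omega⟩
    by_contra hlt
    have := mem_part_symm (hP i x j y (by omega) (by omega) (by omega) h (hpart hB hx hy))
    rw [P.part_eq_of_mem hB hx] at this
    exact hiB this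

/-- Two elements of `Fin L` are related when the corresponding odd positions of the word have the
same height and the word does not go below this height in between. -/
def sameLevel (D : Finset ℕ) (i j : ℕ) : Prop :=
  height D (2 * i + 1) = height D (2 * j + 1) ∧
    ∀ t, (2 * i + 1 ≤ t ∧ t ≤ 2 * j + 1 ∨ 2 * j + 1 ≤ t ∧ t ≤ 2 * i + 1) →
      height D (2 * i + 1) ≤ height D t

lemma sameLevel.symm {D : Finset ℕ} {i j : ℕ} (h : sameLevel D i j) : sameLevel D j i :=
  ⟨h.1.symm, fun t ht => h.1 ▸ h.2 t ht.symm⟩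

lemma sameLevel.trans {D : Finset ℕ} {i j k : ℕ} (h : sameLevel D i j) (h' : sameLevel D j k) :
    sameLevel D i k := by
  refine ⟨h.1.trans h'.1, fun t ht => ?_⟩
  by_cases hc : 2 * i + 1 ≤ t ∧ t ≤ 2 * j + 1 ∨ 2 * j + 1 ≤ t ∧ t ≤ 2 * i + 1
  · exact h.2 t hc
  · rw [h.1]
    exact h'.2 t (by omega)

/-- The relation `sameLevel` as a setoid on `Fin L`. -/
def levelSetoid (L : ℕ) (D : Finset ℕ) : Setoid (Fin L) where
  r i j := sameLevel D i j
  iseqv := ⟨fun i => ⟨rfl, fun t ht => by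
    obtain rfl : t = 2 * i + 1 := by omega
    rfl⟩,
    sameLevel.symm, sameLevel.trans⟩

open Classical in
/-- The partition of `Fin L` encoded by a word. -/
noncomputable def ofWord (L : ℕ) (D : Finset ℕ) : Finpartition (univ : Finset (Fin L)) :=
  Finpartition.ofSetoid (levelSetoid L D)

lemma mem_part_ofWord {D : Finset ℕ} {i j : Fin L} :
    j ∈ (ofWord L D).part i ↔ sameLevel D i j := by
  classical
  exact Finpartition.mem_part_ofSetoid_iff_rel

lemma nonCrossing_ofWord (D : Finset ℕ) : NonCrossing (ofWord L D) := by
  rw [nonCrossing_iff]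
  intro a b c d hab hbc hcd hac hbd
  rw [mem_part_ofWord] at *
  have h₁ := hac.2 (2 * b + 1) (by omega)
  have h₂ := hbd.2 (2 * c + 1) (by omega)
  have h₃ := hac.1
  exact ⟨by omega, fun t ht => hac.2 t (by omega)⟩

lemma wordOf_ofWord {D : Finset ℕ} (hD : D ∈ dyckWords L) : wordOf (ofWord L D) = D := by
  obtain ⟨h₁, h₂, h₃⟩ := mem_dyckWords.1 hD
  refine finset_ext_of_two_mul (wordOf_subset _) h₁ (fun i => ?_) (fun i => ?_)
  · rw [two_mul_mem_wordOf]
    simp only [mem_part_ofWord]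
    constructor
    · rintro ⟨j, hj, hji⟩
      by_contra hi
      have := hj.2 (2 * i) (by omega)
      have := height_succ_of_notMem hi
      omega
    · intro hi
      have hs := height_succ_of_mem hi
      have hnn := h₂ (2 * i + 1) (by omega)
      let p : ℕ → Prop := fun t => height D t ≤ height D (2 * i + 1)
      have hp0 : p 0 := by simpa [p] using hnn
      set t := Nat.findGreatest p (2 * i) with ht
      have hpt : p t := Nat.findGreatest_spec (Nat.zero_le _) hp0
      have hle : t ≤ 2 * i := Nat.findGreatest_le _
      have hgt : ∀ s, t < s → s ≤ 2 * i → height D (2 * i + 1) < height D s :=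
        fun s h h' => not_le.1 (Nat.findGreatest_is_greatest h h')
      have hne : t ≠ 2 * i := by
        intro he
        rw [he] at hpt
        simp only [p] at hpt
        omega
      have hnext := hgt (t + 1) (by omega) (by omega)
      have heq : height D t = height D (2 * i + 1) := by
        simp only [p] at hpt
        by_cases hm : t ∈ D
        · have := height_succ_of_mem hm
          omega
        · have := height_succ_of_notMem hm
          omega
      have hpar := height_emod_two D t
      have hpar' := height_emod_two D (2 * i + 1)
      obtain ⟨j, hj⟩ : ∃ j, t = 2 * j + 1 := ⟨t / 2, by push_cast at hpar'; omega⟩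
      refine ⟨⟨j, by omega⟩, ⟨?_, fun s hs => ?_⟩, by rw [Fin.lt_def]; simp only; omega⟩
      · rw [← hj, heq]
      · simp only [← hj] at hs
        rcases eq_or_ne s t with rfl | h
        · exact heq.ge
        rcases eq_or_ne s (2 * i + 1) with rfl | h'
        · exact le_rfl
        exact (hgt s (by omega) (by omega)).le
  · rw [two_mul_add_one_mem_wordOf]
    simp only [mem_part_ofWord]
    constructor
    · contrapose!
      intro hi
      have hs := height_succ_of_notMem hi
      have hnn := h₂ (2 * i + 1) (by omega)
      have hex : ∃ t, 2 * (i : ℕ) + 1 < t ∧ height D t ≤ height D (2 * i + 1) :=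
        ⟨2 * L, by omega, by omega⟩
      classical
      set t := Nat.find hex with ht
      obtain ⟨hlt, hpt⟩ := Nat.find_spec hex
      rw [← ht] at hlt hpt
      have hle : t ≤ 2 * L := Nat.find_min' hex ⟨by omega, by omega⟩
      have hgt : ∀ s, 2 * (i : ℕ) + 1 < s → s < t → height D (2 * i + 1) < height D s :=
        fun s h h' => not_le.1 fun h'' => Nat.find_min hex h' ⟨h, h''⟩
      obtain ⟨r, hr⟩ : ∃ r, t = r + 1 := ⟨t - 1, by omega⟩
      have hne : r ≠ 2 * i + 1 := by
        intro he
        rw [hr, he] at hpt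
        omega
      have hprev := hgt r (by omega) (by omega)
      have heq : height D t = height D (2 * i + 1) := by
        rw [hr] at hpt ⊢
        by_cases hm : r ∈ D
        · have := height_succ_of_mem hm
          omega
        · have := height_succ_of_notMem hm
          omega
      have hpar := height_emod_two D t
      have hpar' := height_emod_two D (2 * i + 1)
      obtain ⟨j, hj⟩ : ∃ j, t = 2 * j + 1 := ⟨t / 2, by push_cast at hpar'; omega⟩
      refine ⟨⟨j, by omega⟩, ⟨?_, fun s hs => ?_⟩, by rw [Fin.lt_def]; simp only; omega⟩
      · rw [← hj, heq]
      · simp only [← hj] at hs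
        rcases eq_or_ne s t with rfl | h
        · exact heq.ge
        rcases eq_or_ne s (2 * i + 1) with rfl | h'
        · exact le_rfl
        exact (hgt s (by omega) (by omega)).le
    · intro hi j hj
      by_contra hlt
      have := hj.2 (2 * i + 1 + 1) (by omega)
      have := height_succ_of_mem hi
      omega

lemma sameLevel_wordOf_of_lt {P : Finpartition (univ : Finset (Fin L))} (hP : NonCrossing P)
    {i j : Fin L} (hij : i < j) (h : j ∈ P.part i) : sameLevel (wordOf P) i j := by
  have hstr := straddling_eq_of_mem_part hP hij h
  refine ⟨?_, fun t ht => ?_⟩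
  · rw [height_wordOf_two_mul_add_one, height_wordOf_two_mul_add_one, hstr]
  · have hsub : ∀ a b : ℕ, i < a → b ≤ j → straddling P (i + 1) i ⊆ straddling P a b := by
      intro a b ha hb B hB
      have hB' := hstr ▸ hB
      simp only [mem_straddling] at hB hB' ⊢
      obtain ⟨hBP, ⟨x, hx, hxi⟩, -⟩ := hB
      obtain ⟨-, -, y, hy, hjy⟩ := hB'
      exact ⟨hBP, ⟨x, hx, by omega⟩, y, hy, by omega⟩
    rw [height_wordOf_two_mul_add_one]
    rcases Nat.even_or_odd' t with ⟨k, rfl | rfl⟩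
    · rw [height_wordOf_two_mul P (by omega)]
      have := card_le_card (hsub k k (by omega) (by omega))
      omega
    · have := card_le_card (hsub (k + 1) k (by omega) (by omega))
      have e := height_wordOf_two_mul_add_one P ⟨k, by omega⟩
      simp only at e
      omega

lemma sameLevel_wordOf {P : Finpartition (univ : Finset (Fin L))} (hP : NonCrossing P)
    {i j : Fin L} (h : j ∈ P.part i) : sameLevel (wordOf P) i j := by
  rcases lt_trichotomy i j with hij | rfl | hij
  · exact sameLevel_wordOf_of_lt hP hij h
  · exact (levelSetoid L (wordOf P)).refl i
  · exact (sameLevel_wordOf_of_lt hP hij (mem_part_symm h)).symm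

lemma exists_least_mem_part (P : Finpartition (univ : Finset (Fin L))) (i : Fin L) :
    ∃ m ∈ P.part i, ∀ j ∈ P.part m, m ≤ j := by
  have hne : (P.part i).Nonempty := P.part_nonempty.2 (mem_univ i)
  exact ⟨(P.part i).min' hne, min'_mem _ _, fun j hj =>
    min'_le _ _ (mem_part_trans (min'_mem _ _) hj)⟩

lemma ofWord_wordOf {P : Finpartition (univ : Finset (Fin L))} (hP : NonCrossing P) :
    ofWord L (wordOf P) = P := by
  set Q := ofWord L (wordOf P) with hQ
  have hPQ : ∀ {i j}, j ∈ P.part i → j ∈ Q.part i :=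
    fun h => mem_part_ofWord.2 (sameLevel_wordOf hP h)
  have hword : wordOf Q = wordOf P := wordOf_ofWord (wordOf_mem_dyckWords P)
  have hleast : ∀ m, (∀ j ∈ P.part m, m ≤ j) → ∀ j ∈ Q.part m, m ≤ j := by
    intro m
    have h₁ := two_mul_mem_wordOf (P := P) (i := m)
    rw [← hword, two_mul_mem_wordOf] at h₁
    contrapose!
    exact h₁.1
  refine Finpartition.eq_of_mem_part_iff fun i j => ⟨fun h => ?_, hPQ⟩
  obtain ⟨m, hm, hm'⟩ := exists_least_mem_part P i
  obtain ⟨n, hn, hn'⟩ := exists_least_mem_part P j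
  have hmn : n ∈ Q.part m := mem_part_trans (mem_part_symm (hPQ hm)) (mem_part_trans h (hPQ hn))
  obtain rfl : m = n := le_antisymm (hleast m hm' n hmn) (hleast n hn' m (mem_part_symm hmn))
  exact mem_part_trans hm (mem_part_symm hn)

/-! ### Reflection -/

/-- The reflected partition. -/
def reflection (P : Finpartition (univ : Finset (Fin L))) : Finpartition (univ : Finset (Fin L)) :=
  Finpartition.ofExistsUnique (reflParts P) (fun _ _ => subset_univ _)
    (by
      intro a _
      refine ⟨(P.part a.rev).image Fin.rev, ⟨mem_image_of_mem _ (P.part_mem.2 (mem_univ _)),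
        mem_image.2 ⟨a.rev, P.mem_part (mem_univ _), Fin.rev_rev a⟩⟩, ?_⟩
      rintro _ ⟨hB, ha⟩
      obtain ⟨B, hBP, rfl⟩ := mem_image.1 hB
      obtain ⟨x, hx, rfl⟩ := mem_image.1 ha
      rw [Fin.rev_rev, P.part_eq_of_mem hBP hx])
    (by
      intro h
      obtain ⟨B, hB, hB'⟩ := mem_image.1 h
      exact P.ne_empty hB (image_eq_empty.1 hB'))

@[simp] lemma reflection_parts (P : Finpartition (univ : Finset (Fin L))) :
    (reflection P).parts = reflParts P := rfl

lemma mem_part_reflection {P : Finpartition (univ : Finset (Fin L))} {i j : Fin L} :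
    j ∈ (reflection P).part i ↔ j.rev ∈ P.part i.rev := by
  have : (reflection P).part i = (P.part i.rev).image Fin.rev := by
    refine Finpartition.part_eq_of_mem _ (mem_image_of_mem _ (P.part_mem.2 (mem_univ _))) ?_
    exact mem_image.2 ⟨i.rev, P.mem_part (mem_univ _), Fin.rev_rev i⟩
  rw [this, mem_image]
  constructor
  · rintro ⟨x, hx, rfl⟩
    rwa [Fin.rev_rev]
  · exact fun h => ⟨_, h, Fin.rev_rev j⟩

lemma reflection_reflection (P : Finpartition (univ : Finset (Fin L))) : reflection (reflection P) = P :=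
  Finpartition.eq_of_mem_part_iff fun i j => by simp [mem_part_reflection]

lemma NonCrossing.reflection {P : Finpartition (univ : Finset (Fin L))} (hP : NonCrossing P) :
    NonCrossing (reflection P) := by
  rw [nonCrossing_iff] at hP ⊢
  intro a b c d hab hbc hcd hac hbd
  rw [mem_part_reflection] at hac hbd ⊢
  have := hP d.rev c.rev b.rev a.rev (Fin.rev_lt_rev.2 hcd) (Fin.rev_lt_rev.2 hbc)
    (Fin.rev_lt_rev.2 hab) (mem_part_symm hbd) (mem_part_symm hac)
  exact mem_part_trans hac (mem_part_trans (mem_part_symm this) (mem_part_symm hbd))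

lemma wordOf_reflection (P : Finpartition (univ : Finset (Fin L))) :
    wordOf (reflection P) = revWord L (wordOf P) := by
  refine finset_ext_of_two_mul (wordOf_subset _) (filter_subset _ _) (fun i => ?_) (fun i => ?_)
  · rw [two_mul_mem_wordOf, mem_revWord,
      show 2 * L - 1 - 2 * (i : ℕ) = 2 * (i.rev : ℕ) + 1 by rw [Fin.val_rev]; omega,
      two_mul_add_one_mem_wordOf]
    simp only [mem_part_reflection]
    push Not
    constructor
    · rintro ⟨j, hj, hji⟩
      exact ⟨by omega, j.rev, hj, Fin.rev_lt_rev.2 hji⟩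
    · rintro ⟨-, j, hj, hji⟩
      exact ⟨j.rev, by rwa [Fin.rev_rev], Fin.rev_lt_rev.1 (by rwa [Fin.rev_rev])⟩
  · rw [two_mul_add_one_mem_wordOf, mem_revWord,
      show 2 * L - 1 - (2 * (i : ℕ) + 1) = 2 * (i.rev : ℕ) by rw [Fin.val_rev]; omega,
      two_mul_mem_wordOf]
    simp only [mem_part_reflection]
    push Not
    constructor
    · refine fun h => ⟨by omega, fun j hj => ?_⟩
      have := h j.rev (by rwa [Fin.rev_rev])
      rwa [← Fin.rev_le_rev, Fin.rev_rev] at this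
    · rintro ⟨-, h⟩ j hj
      exact Fin.rev_le_rev.1 (h _ hj)

open Classical in
/-- The finset of non-crossing partitions. -/
noncomputable def nonCrossings (L : ℕ) : Finset (Finpartition (univ : Finset (Fin L))) :=
  {P | NonCrossing P}

lemma mem_nonCrossings {P : Finpartition (univ : Finset (Fin L))} :
    P ∈ nonCrossings L ↔ NonCrossing P := by simp [nonCrossings]

theorem card_nonCrossings (L : ℕ) : #(nonCrossings L) = #(dyckWords L) :=
  card_nbij' wordOf (ofWord L) (fun P _ => wordOf_mem_dyckWords P)
    (fun D _ => mem_nonCrossings.2 (nonCrossing_ofWord D))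
    (fun _ hP => ofWord_wordOf (mem_nonCrossings.1 hP)) (fun _ hD => wordOf_ofWord hD)

lemma reflection_eq_iff {P : Finpartition (univ : Finset (Fin L))} (hP : NonCrossing P) :
    reflection P = P ↔ revWord L (wordOf P) = wordOf P := by
  rw [← wordOf_reflection]
  refine ⟨fun h => by rw [h], fun h => ?_⟩
  rw [← ofWord_wordOf hP.reflection, h, ofWord_wordOf hP]

theorem card_filter_reflection_eq (L : ℕ) :
    #{P ∈ nonCrossings L | reflection P = P} = L.choose (L / 2) := by
  rw [← card_filter_revWord_eq]
  refine card_nbij' wordOf (ofWord L) ?_ ?_ ?_ ?_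
  · intro P hP
    obtain ⟨hP, h⟩ := mem_filter.1 hP
    exact mem_filter.2 ⟨wordOf_mem_dyckWords P, (reflection_eq_iff (mem_nonCrossings.1 hP)).1 h⟩
  · intro D hD
    obtain ⟨hD, h⟩ := mem_filter.1 hD
    refine mem_filter.2 ⟨mem_nonCrossings.2 (nonCrossing_ofWord D), ?_⟩
    rwa [reflection_eq_iff (nonCrossing_ofWord D), wordOf_ofWord hD]
  · exact fun P hP => ofWord_wordOf (mem_nonCrossings.1 (mem_filter.1 hP).1)
  · exact fun D hD => wordOf_ofWord (mem_filter.1 hD).1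

end

/-- Counting the orbits of an involution. -/
lemma two_mul_card_image_of_involution {α β : Type*} [DecidableEq α] [DecidableEq β]
    (X : Finset α) (σ : α → α) (hσ : ∀ x ∈ X, σ x ∈ X) (hσσ : ∀ x, σ (σ x) = x) (f : α → β)
    (hf : ∀ x y, f y = f x ↔ y = x ∨ y = σ x) :
    2 * #(X.image f) = #X + #{x ∈ X | σ x = x} := by
  have hX : #X = ∑ b ∈ X.image f, #{x ∈ X | f x = b} := card_eq_sum_card_image f X
  have hfix : #{x ∈ X | σ x = x} = ∑ b ∈ X.image f, #{x ∈ {x ∈ X | σ x = x} | f x = b} :=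
    card_eq_sum_card_fiberwise fun x hx => mem_image_of_mem f (mem_filter.1 hx).1
  rw [hX, hfix, ← sum_add_distrib, mul_comm, ← smul_eq_mul, ← sum_const]
  refine sum_congr rfl fun b hb => ?_
  obtain ⟨x, hx, rfl⟩ := mem_image.1 hb
  have hfib : {y ∈ X | f y = f x} = {x, σ x} := by
    ext y
    simp only [mem_filter, hf, mem_insert, mem_singleton, and_iff_right_iff_imp]
    rintro (rfl | rfl)
    exacts [hx, hσ _ hx]
  rw [filter_comm, hfib]
  by_cases h : σ x = x
  · simp [h, filter_singleton]
  · have h₂ : ∀ y ∈ ({x, σ x} : Finset α), ¬ σ y = y := by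
      simp [hσσ, h, Ne.symm h]
    rw [card_pair (Ne.symm h), filter_false_of_mem h₂, card_empty]

theorem two_mul_ncard_reflClasses (L : ℕ) :
    2 * (reflClasses L).ncard = #(nonCrossings L) + #{P ∈ nonCrossings L | reflection P = P} := by
  classical
  rw [← two_mul_card_image_of_involution (nonCrossings L) reflection
    (fun P hP => mem_nonCrossings.2 (mem_nonCrossings.1 hP).reflection) reflection_reflection
    (fun P => ({P.parts, reflParts P} : Set (Finset (Finset (Fin L)))))]
  · rw [← Set.ncard_coe_finset]
    congr 2
    simp [reflClasses, nonCrossings]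
  · intro P Q
    simp only [← reflection_parts, Set.pair_eq_pair_iff, ← Finpartition.ext_iff]
    constructor
    · rintro (⟨h, -⟩ | ⟨h, -⟩)
      exacts [Or.inl h, Or.inr h]
    · rintro (rfl | rfl)
      exacts [Or.inl ⟨rfl, rfl⟩, Or.inr ⟨rfl, reflection_reflection P⟩]

/-- For even `L > 0`, the number of equivalence classes of non-crossing partitions of
`{1,…,L}` under the reflection `τ(i) = L+1−i` equals `(1/2)·[C_L + binom(L, L/2)]`. -/
theorem noncrossing_reflection_classes (L : ℕ) (hL : 0 < L) (hE : Even L) :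
    ((reflClasses L).ncard : ℚ)
      = (1 / 2) * ((1 / (L + 1)) * (Nat.choose (2 * L) L) + Nat.choose L (L / 2)) := by
  have h₁ := two_mul_ncard_reflClasses L
  rw [card_nonCrossings, card_filter_reflection_eq] at h₁
  have h₂ := card_dyckWords hL
  have h₃ : (2 * L).choose (L - 1) * (L + 1) = (2 * L).choose L * L := by
    obtain ⟨k, rfl⟩ : ∃ k, L = k + 1 := ⟨L - 1, by omega⟩
    have := Nat.choose_succ_right_eq (2 * (k + 1)) k
    rw [this, Nat.add_sub_cancel]
    congr 1
    omega
  have hL' : (L : ℚ) + 1 ≠ 0 := by positivity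
  qify at h₁ h₂ h₃
  have h₄ : (#(dyckWords L) : ℚ) = 1 / (L + 1) * (2 * L).choose L := by
    field_simp
    linear_combination (L + 1 : ℚ) * h₂ - h₃
  rw [← h₄]
  linear_combination h₁ / 2
end

section
/- Let L be an even positive integer. Let N_L denote the number of orbits of the set of non-crossing partitions of {1,…,L} under the group of permutations generated by the rotation ρ₂ (ρ₂(i) = i+2 reduced modulo L to lie in {1,…,L}) and the reflection τ (τ(i) = L+1−i), acting on partitions by σ·P = {σ(B) : B ∈ P}. Then N_L = (1/2)·binom(L, L/2) + (1/L)·[ C_L + Σ_{d even, d | L, 1 ≤ d < L} φ(L/d)·binom(2d, d) ], where C_L is the number of non-crossing partitions of {1,…,L} (the Catalan number) and φ is Euler's totient function. (Theorem 3 of the paper: N_L = N_{Z,hc,PF,L_y}, the number of eigenvalues λ in the Potts partition function of honeycomb-lattice strips of even width L_y with cylindrical boundary conditions.) -/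
open Finset

/-- The set of parts of the image `σ·P = {σ(B) : B ∈ P}` of a partition `P` under a
permutation `σ`. -/
def permParts {L : ℕ} (σ : Equiv.Perm (Fin L))
    (P : Finpartition (Finset.univ : Finset (Fin L))) : Finset (Finset (Fin L)) :=
  P.parts.image (fun B => B.image σ)

/-- The orbit of a partition `P` under a subgroup `H` of permutations (acting by
`σ·P = {σ(B) : B ∈ P}`), as a set of partitions. -/
def orbitSet {L : ℕ} (H : Subgroup (Equiv.Perm (Fin L)))
    (P : Finpartition (Finset.univ : Finset (Fin L))) :
    Set (Finpartition (Finset.univ : Finset (Fin L))) :=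
  {Q | ∃ σ ∈ H, Q.parts = permParts σ P}

namespace NoncrossingOrbits

/-- Non-crossing equivalence relations on the integers which are invariant under translation
by `g`. -/
def periodicNC (g : ℤ) : Set (Setoid ℤ) :=
  {R | (∀ a b c d, a < b → b < c → c < d → R a c → R b d → R a b) ∧
    ∀ i j, R i j ↔ R (i + g) (j + g)}

/-- Bi-infinite lattice walks with steps `±1` through the origin, periodic with period `2 * g`. -/
def periodicWalks (g : ℤ) : Set (ℤ → ℤ) :=
  {h | h 0 = 0 ∧ (∀ t, h (t + 1) = h t + 1 ∨ h (t + 1) = h t - 1) ∧ ∀ t, h (t + 2 * g) = h t}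

/-- The equivalence relation on the integers attached to a height function: `i` and `j` are
related when the heights at the odd times `2 * i + 1` and `2 * j + 1` agree and the height does
not drop below that level in between. -/
def ofHeight (h : ℤ → ℤ) : Setoid ℤ where
  r i j := h (2 * i + 1) = h (2 * j + 1) ∧
    ∀ t, min (2 * i + 1) (2 * j + 1) ≤ t → t ≤ max (2 * i + 1) (2 * j + 1) → h (2 * i + 1) ≤ h t
  iseqv := by
    refine ⟨fun i => ⟨rfl, fun t h1 h2 => ?_⟩, ?_, ?_⟩
    · have : t = 2 * i + 1 := by simp at h1 h2; omega
      rw [this]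
    · rintro i j ⟨h1, h2⟩
      refine ⟨h1.symm, fun t h3 h4 => ?_⟩
      rw [← h1]
      exact h2 t (by rwa [min_comm]) (by rwa [max_comm])
    · rintro i j k ⟨h1, h2⟩ ⟨h3, h4⟩
      refine ⟨h1.trans h3, fun t h5 h6 => ?_⟩
      rcases (show (min (2 * i + 1) (2 * j + 1) ≤ t ∧ t ≤ max (2 * i + 1) (2 * j + 1)) ∨
        (min (2 * j + 1) (2 * k + 1) ≤ t ∧ t ≤ max (2 * j + 1) (2 * k + 1)) by omega) with h7 | h7
      · exact h2 t h7.1 h7.2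
      · rw [h1]; exact h4 t h7.1 h7.2

theorem ofHeight_iff {h : ℤ → ℤ} {i j : ℤ} (hij : i ≤ j) : ofHeight h i j ↔
    h (2 * i + 1) = h (2 * j + 1) ∧ ∀ t, 2 * i + 1 ≤ t → t ≤ 2 * j + 1 → h (2 * i + 1) ≤ h t := by
  change (_ ∧ _) ↔ _
  rw [min_eq_left (by omega), max_eq_right (by omega)]

theorem ofHeight_mem_periodicNC {g : ℤ} {h : ℤ → ℤ} (hp : ∀ t, h (t + 2 * g) = h t) :
    ofHeight h ∈ periodicNC g := by
  refine ⟨fun a b c d hab hbc hcd hac hbd => ?_, ?_⟩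
  · rw [ofHeight_iff (by omega)] at hac hbd ⊢
    have h1 := hac.2 (2 * b + 1) (by omega) (by omega)
    have h2 := hbd.2 (2 * c + 1) (by omega) (by omega)
    exact ⟨by omega, fun t h3 h4 => hac.2 t h3 (by omega)⟩
  · have key : ∀ i j, i ≤ j → (ofHeight h i j ↔ ofHeight h (i + g) (j + g)) := by
      intro i j hij
      rw [ofHeight_iff hij, ofHeight_iff (by omega)]
      have e1 : ∀ i, h (2 * (i + g) + 1) = h (2 * i + 1) := fun i => by
        rw [← hp (2 * i + 1)]; ring_nf
      rw [e1, e1]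
      refine and_congr_right fun _ => ⟨fun H t h1 h2 => ?_, fun H t h1 h2 => ?_⟩
      · have := H (t - 2 * g) (by omega) (by omega)
        rwa [← hp (t - 2 * g), sub_add_cancel] at this
      · rw [← hp t]
        exact H _ (by omega) (by omega)
    intro i j
    rcases le_total i j with hij | hij
    · exact key i j hij
    · rw [Setoid.comm' _, key j i hij, Setoid.comm' _]

theorem ofHeight_reflect (h : ℤ → ℤ) (i j : ℤ) :
    ofHeight (fun t => h (-t)) i j ↔ ofHeight h (-1 - i) (-1 - j) := by
  change (_ ∧ _) ↔ (_ ∧ _)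
  have e : ∀ i : ℤ, 2 * (-1 - i) + 1 = -(2 * i + 1) := fun i => by ring
  simp only [e, min_neg_neg, max_neg_neg]
  refine and_congr_right fun _ => ⟨fun H t h1 h2 => ?_, fun H t h1 h2 => ?_⟩
  · have := H (-t) (by omega) (by omega)
    rwa [neg_neg] at this
  · exact H (-t) (by omega) (by omega)

theorem reflect_mem_periodicWalks {g : ℤ} {h : ℤ → ℤ} (hh : h ∈ periodicWalks g) :
    (fun t => h (-t)) ∈ periodicWalks g := by
  obtain ⟨h0, hs, hp⟩ := hh
  refine ⟨by simpa using h0, fun t => ?_, fun t => ?_⟩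
  · have := hs (-(t + 1))
    rw [show -(t + 1) + 1 = -t by ring] at this
    simp only
    omega
  · simp only
    rw [← hp]
    ring_nf

theorem height_even {h : ℤ → ℤ} (h0 : h 0 = 0)
    (hs : ∀ t, h (t + 1) = h t + 1 ∨ h (t + 1) = h t - 1) (t : ℤ) : 2 ∣ h t - t := by
  induction t with
  | zero => simp [h0]
  | succ i ih => have := hs i; omega
  | pred i ih => have := hs (-i - 1); rw [sub_add_cancel] at this; omega

theorem exists_gt_ofHeight_iff {g : ℤ} (hg : 0 < g) {h : ℤ → ℤ} (hh : h ∈ periodicWalks g)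
    (i : ℤ) : (∃ j, i < j ∧ ofHeight h i j) ↔ h (2 * i + 1 + 1) = h (2 * i + 1) + 1 := by
  have hpar := height_even hh.1 hh.2.1
  obtain ⟨h0, hs, hp⟩ := hh
  constructor
  · rintro ⟨j, hij, hr⟩
    rw [ofHeight_iff hij.le] at hr
    have := hr.2 (2 * i + 1 + 1) (by omega) (by omega)
    have := hs (2 * i + 1)
    omega
  · intro hup
    have hex : ∃ n : ℕ, 0 < n ∧ h (2 * i + 1 + n) ≤ h (2 * i + 1) :=
      ⟨(2 * g).toNat, by omega, by rw [Int.toNat_of_nonneg (by omega), hp]⟩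
    classical
    obtain ⟨hn0, hn⟩ := Nat.find_spec hex
    set n := Nat.find hex
    have hmin : ∀ m : ℕ, 0 < m → m < n → h (2 * i + 1) < h (2 * i + 1 + m) := fun m h1 h2 => by
      have := Nat.find_min hex h2
      push Not at this
      exact this h1
    have hn1 : n ≠ 1 := fun h1 => by rw [h1] at hn; push_cast at hn; omega
    have h1 := hmin (n - 1) (by omega) (by omega)
    have h2 := hs (2 * i + 1 + ((n - 1 : ℕ) : ℤ))
    rw [show 2 * i + 1 + ((n - 1 : ℕ) : ℤ) + 1 = 2 * i + 1 + n by omega] at h2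
    have h3 := hpar (2 * i + 1)
    have h4 := hpar (2 * i + 1 + n)
    refine ⟨i + n / 2, by omega, ?_⟩
    rw [ofHeight_iff (by omega), show 2 * (i + (n : ℤ) / 2) + 1 = 2 * i + 1 + n by omega]
    refine ⟨by omega, fun t h5 h6 => ?_⟩
    rcases eq_or_lt_of_le h5 with rfl | h5
    · rfl
    rcases eq_or_lt_of_le h6 with rfl | h6
    · omega
    have := hmin (t - (2 * i + 1)).toNat (by omega) (by omega)
    rw [show 2 * i + 1 + ((t - (2 * i + 1)).toNat : ℤ) = t by omega] at this
    exact this.le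

theorem exists_lt_ofHeight_iff {g : ℤ} (hg : 0 < g) {h : ℤ → ℤ} (hh : h ∈ periodicWalks g)
    (i : ℤ) : (∃ j, j < i ∧ ofHeight h j i) ↔ h (2 * i + 1) = h (2 * i) - 1 := by
  have := exists_gt_ofHeight_iff hg (reflect_mem_periodicWalks hh) (-1 - i)
  rw [show -(2 * (-1 - i) + 1 + 1) = 2 * i by ring, show -(2 * (-1 - i) + 1) = 2 * i + 1 by ring]
    at this
  rw [show (h (2 * i + 1) = h (2 * i) - 1) ↔ h (2 * i) = h (2 * i + 1) + 1 by omega, ← this]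
  constructor
  · rintro ⟨j, hj, hr⟩
    refine ⟨-1 - j, by omega, ?_⟩
    rw [ofHeight_reflect]
    simpa using (ofHeight h).symm hr
  · rintro ⟨j, hj, hr⟩
    rw [ofHeight_reflect] at hr
    exact ⟨-1 - j, by omega, by simpa using (ofHeight h).symm hr⟩

theorem eq_of_steps {h h' : ℤ → ℤ} (h0 : h 0 = h' 0)
    (hs : ∀ t, h (t + 1) - h t = h' (t + 1) - h' t) : h = h' := by
  funext t
  induction t with
  | zero => exact h0
  | succ i ih => have := hs i; omega
  | pred i ih => have := hs (-i - 1); rw [sub_add_cancel] at this; omega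

theorem injOn_ofHeight {g : ℤ} (hg : 0 < g) : Set.InjOn ofHeight (periodicWalks g) := by
  intro h hh h' hh' he
  refine eq_of_steps (by rw [hh.1, hh'.1]) fun t => ?_
  have s := hh.2.1 t
  have s' := hh'.2.1 t
  rcases Int.even_or_odd' t with ⟨i, rfl | rfl⟩
  · have h1 := exists_lt_ofHeight_iff hg hh i
    have h2 := exists_lt_ofHeight_iff hg hh' i
    rw [he] at h1
    have h3 := h1.symm.trans h2
    clear h1 h2
    omega
  · have h1 := exists_gt_ofHeight_iff hg hh i
    have h2 := exists_gt_ofHeight_iff hg hh' i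
    rw [he] at h1
    have h3 := h1.symm.trans h2
    clear h1 h2
    omega

theorem exists_height_of_steps (s : ℤ → ℤ) : ∃ h : ℤ → ℤ, h 0 = 0 ∧ ∀ t, h (t + 1) = h t + s t := by
  refine ⟨fun t => ∑ x ∈ Finset.Ico 0 t, s x - ∑ x ∈ Finset.Ico t 0, s x, by simp, fun t => ?_⟩
  simp only
  rcases le_or_gt 0 t with ht | ht
  · rw [Finset.Ico_eq_empty (a := t) (by omega), Finset.Ico_eq_empty (a := t + 1) (by omega),
      ← Finset.insert_Ico_right_eq_Ico_add_one ht, Finset.sum_insert (by simp)]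
    simp [add_comm]
  · rw [Finset.Ico_eq_empty (b := t) (by omega), Finset.Ico_eq_empty (b := t + 1) (by omega),
      ← Finset.insert_Ico_add_one_left_eq_Ico ht, Finset.sum_insert (by simp)]
    simp

/-- The height function `h` is compatible with `R`: the step before time `2 * i + 1` goes down
exactly when `i` is related to a smaller integer, and the step after that time goes up exactly
when `i` is related to a larger integer. -/
structure IsHeight (R : Setoid ℤ) (h : ℤ → ℤ) : Prop where
  down : ∀ i j, j < i → R j i → h (2 * i + 1) = h (2 * i) - 1
  not_down : ∀ i, (∀ j, j < i → ¬ R j i) → h (2 * i + 1) = h (2 * i) + 1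
  up : ∀ i j, i < j → R i j → h (2 * i + 2) = h (2 * i + 1) + 1
  not_up : ∀ i, (∀ j, i < j → ¬ R i j) → h (2 * i + 2) = h (2 * i + 1) - 1

theorem exists_isHeight (R : Setoid ℤ) : ∃ h : ℤ → ℤ, h 0 = 0 ∧
    (∀ t, h (t + 1) = h t + 1 ∨ h (t + 1) = h t - 1) ∧ IsHeight R h := by
  classical
  obtain ⟨h, h0, hs⟩ := exists_height_of_steps fun t =>
    if t % 2 = 0 then (if ∃ j, j < t / 2 ∧ R j (t / 2) then -1 else 1)
    else (if ∃ j, t / 2 < j ∧ R (t / 2) j then 1 else -1)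
  have e1 : ∀ i : ℤ, (2 * i + 1) / 2 = i := fun i => by omega
  have e2 : ∀ i : ℤ, (2 * i + 1) % 2 = 1 := fun i => by omega
  refine ⟨h, h0, fun t => ?_, fun i j hj hr => ?_, fun i hi => ?_, fun i j hj hr => ?_,
    fun i hi => ?_⟩
  · rw [hs]
    split_ifs <;> simp [sub_eq_add_neg]
  · rw [hs, if_pos (by simp), if_pos ⟨j, by simpa using hj, by simpa using hr⟩]; rfl
  · rw [hs, if_pos (by simp), if_neg (by simpa using hi)]
  · rw [show 2 * i + 2 = 2 * i + 1 + 1 by ring, hs, e1, e2, if_neg (by simp), if_pos ⟨j, hj, hr⟩]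
  · rw [show 2 * i + 2 = 2 * i + 1 + 1 by ring, hs, e1, e2, if_neg (by simp),
      if_neg (by simpa using hi)]; rfl

theorem exists_next {R : Setoid ℤ} {i j : ℤ} (hij : i < j) (hr : R i j) :
    ∃ k, i < k ∧ k ≤ j ∧ R i k ∧ ∀ l, i < l → l < k → ¬ R i l := by
  classical
  have hex : ∃ n : ℕ, 0 < n ∧ R i (i + n) :=
    ⟨(j - i).toNat, by omega, by rwa [show i + ((j - i).toNat : ℤ) = j by omega]⟩
  obtain ⟨h1, h2⟩ := Nat.find_spec hex
  have hle : Nat.find hex ≤ (j - i).toNat := Nat.find_min' hex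
    ⟨by omega, by rwa [show i + ((j - i).toNat : ℤ) = j by omega]⟩
  refine ⟨i + Nat.find hex, by omega, by omega, h2, fun l h3 h4 hl => ?_⟩
  exact Nat.find_min hex (m := (l - i).toNat) (by omega)
    ⟨by omega, by rwa [show i + ((l - i).toNat : ℤ) = l by omega]⟩

theorem IsHeight.interval {R : Setoid ℤ} {h : ℤ → ℤ} (hR : IsHeight R h)
    (hnc : ∀ a b c d, a < b → b < c → c < d → R a c → R b d → R a b) (n : ℕ) :
    ∀ i q : ℤ, i < q → q - i ≤ n → (∀ l, R i l → l < q) →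
      (∀ k l, i < k → k < q → R k l → (i ≤ l ∨ R k i) ∧ l < q) →
      h (2 * q) = h (2 * i + 1) - 1 ∧
        ∀ t, 2 * i + 1 ≤ t → t ≤ 2 * q → h (2 * i + 1) - 1 ≤ h t := by
  induction n with
  | zero => intro i q h1 h2; omega
  | succ n ih =>
    intro i q hiq hn hi hk
    by_cases hnext : ∃ j, i < j ∧ R i j
    · obtain ⟨j, hij, hr⟩ := hnext
      obtain ⟨k, hik, -, hrk, hgap⟩ := exists_next hij hr
      have hkq := hi k hrk
      have hup := hR.up i k hik hrk
      have hdown := hR.down k i hik hrk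
      have hmid : h (2 * k) = h (2 * i + 2) ∧
          ∀ t, 2 * i + 2 ≤ t → t ≤ 2 * k → h (2 * i + 2) ≤ h t := by
        rcases eq_or_lt_of_le (show i + 1 ≤ k by omega) with h1 | h1
        · rw [← h1]
          refine ⟨by ring_nf, fun t h2 h3 => ?_⟩
          rw [show t = 2 * i + 2 by omega]
        · have hin : ∀ l m, i < l → l < k → R l m → i < m ∧ m < k := by
            intro l m h2 h3 h4
            have h5 := hk l m h2 (by omega) h4
            have h5' : ¬ R l i := fun h => hgap l h2 h3 (R.symm h)
            have h6 : m ≠ i := fun h => hgap l h2 h3 (h ▸ R.symm h4)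
            have h7 : m ≠ k := fun h => hgap l h2 h3 (R.trans hrk (R.symm (h ▸ h4)))
            have h9 : i < m := by simp only [h5', or_false] at h5; omega
            refine ⟨h9, ?_⟩
            by_contra h8
            exact hgap l h2 h3 (hnc i l k m h2 h3 (by omega) hrk h4)
          have h2 := ih (i + 1) k h1 (by omega) (fun l hl => (hin _ _ (by omega) h1 hl).2)
            (fun l m h2 h3 h4 => by
              have := hin l m (by omega) h3 h4
              exact ⟨Or.inl (by omega), by omega⟩)
          have h3 := hR.not_down (i + 1) fun j h3 h4 => by
            have := hin _ _ (by omega) h1 (R.symm h4); omega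
          rw [show 2 * (i + 1) = 2 * i + 2 by ring] at h2 h3
          refine ⟨by omega, fun t h4 h5 => ?_⟩
          rcases eq_or_lt_of_le h4 with rfl | h4
          · rfl
          · have := h2.2 t (by omega) h5; omega
      have h3 := ih k q hkq (by omega) (fun l hl => hi l (R.trans hrk hl)) (fun l m h2 h3 h4 => by
        have h5 := hk l m (by omega) h3 h4
        refine ⟨?_, h5.2⟩
        by_cases h6 : R l i
        · exact Or.inr (R.trans h6 hrk)
        have h7 : m ≠ i := fun h => h6 (h ▸ h4)
        simp only [h6, or_false] at h5
        by_contra h8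
        push Not at h8
        exact hgap m (by omega) (by omega)
          (hnc i m k l (by omega) (by omega) h2 hrk (R.symm h4)))
      refine ⟨by omega, fun t h4 h5 => ?_⟩
      rcases eq_or_lt_of_le h4 with rfl | h4
      · omega
      rcases le_or_gt t (2 * k) with h6 | h6
      · have := hmid.2 t (by omega) h6; omega
      · have := h3.2 t (by omega) h5; omega
    · push Not at hnext
      have hdown := hR.not_up i hnext
      rcases eq_or_lt_of_le (show i + 1 ≤ q by omega) with h1 | h1
      · subst h1
        refine ⟨by rw [← hdown]; ring_nf, fun t h2 h3 => ?_⟩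
        rcases eq_or_lt_of_le h2 with rfl | h2
        · omega
        · rw [show t = 2 * i + 2 by omega]; omega
      · have hin : ∀ l m, i < l → l < q → R l m → i < m ∧ m < q := by
          intro l m h2 h3 h4
          have h5 := hk l m h2 h3 h4
          have h6 : ¬ R l i := fun h => hnext l h2 (R.symm h)
          have h7 : m ≠ i := fun h => h6 (h ▸ h4)
          simp only [h6, or_false] at h5
          omega
        have h2 := ih (i + 1) q h1 (by omega) (fun l hl => (hin _ _ (by omega) h1 hl).2)
          (fun l m h2 h3 h4 => by
            have := hin l m (by omega) h3 h4
            exact ⟨Or.inl (by omega), by omega⟩)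
        have h3 := hR.not_down (i + 1) fun j h3 h4 => by
          have := hin _ _ (by omega) h1 (R.symm h4); omega
        rw [show 2 * (i + 1) = 2 * i + 2 by ring] at h2 h3
        refine ⟨by omega, fun t h4 h5 => ?_⟩
        rcases eq_or_lt_of_le h4 with rfl | h4
        · omega
        rcases eq_or_lt_of_le (show 2 * i + 2 ≤ t by omega) with rfl | h6
        · omega
        · have := h2.2 t (by omega) h5; omega

/-- Between two consecutive elements of a class, the height stays strictly above its value at
those elements. -/
theorem IsHeight.consecutive {R : Setoid ℤ} {h : ℤ → ℤ} (hR : IsHeight R h)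
    (hnc : ∀ a b c d, a < b → b < c → c < d → R a c → R b d → R a b) {i k : ℤ} (hik : i < k)
    (hrk : R i k) (hgap : ∀ l, i < l → l < k → ¬ R i l) :
    h (2 * k + 1) = h (2 * i + 1) ∧ ∀ t, 2 * i + 1 < t → t < 2 * k + 1 → h (2 * i + 1) < h t := by
  have hup := hR.up i k hik hrk
  have hdown := hR.down k i hik hrk
  rcases eq_or_lt_of_le (show i + 1 ≤ k by omega) with h1 | h1
  · rw [← h1] at hdown ⊢
    rw [show 2 * (i + 1) = 2 * i + 2 by ring] at hdown ⊢
    refine ⟨by omega, fun t h2 h3 => ?_⟩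
    rw [show t = 2 * i + 2 by omega]
    omega
  · have hin : ∀ l m, i < l → l < k → R l m → i < m ∧ m < k := by
      intro l m h2 h3 h4
      have h6 : m ≠ i := fun h => hgap l h2 h3 (h ▸ R.symm h4)
      have h7 : m ≠ k := fun h => hgap l h2 h3 (R.trans hrk (R.symm (h ▸ h4)))
      constructor
      · by_contra h8
        exact hgap l h2 h3 (R.trans (R.symm (hnc m i l k (by omega) h2 h3 (R.symm h4) hrk))
          (R.symm h4))
      · by_contra h8
        exact hgap l h2 h3 (hnc i l k m h2 h3 (by omega) hrk h4)
    have h2 := hR.interval hnc (k - (i + 1)).toNat (i + 1) k h1 (by omega)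
      (fun l hl => (hin _ _ (by omega) h1 hl).2) (fun l m h2 h3 h4 => by
        have := hin l m (by omega) h3 h4
        exact ⟨Or.inl (by omega), by omega⟩)
    have h3 := hR.not_down (i + 1) fun j h3 h4 => by
      have := hin _ _ (by omega) h1 (R.symm h4); omega
    rw [show 2 * (i + 1) = 2 * i + 2 by ring] at h2 h3
    refine ⟨by omega, fun t h4 h5 => ?_⟩
    rcases eq_or_lt_of_le (show 2 * i + 2 ≤ t by omega) with rfl | h6
    · omega
    · have := h2.2 t (by omega) (by omega); omega

/-- An interval closed under `R` contributes an excursion to the height function. -/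
theorem IsHeight.excursion {R : Setoid ℤ} {h : ℤ → ℤ} (hR : IsHeight R h)
    (hnc : ∀ a b c d, a < b → b < c → c < d → R a c → R b d → R a b) {p q : ℤ} (hpq : p < q)
    (hcl : ∀ k l, p ≤ k → k < q → R k l → p ≤ l ∧ l < q) :
    h (2 * q) = h (2 * p) ∧ ∀ t, 2 * p ≤ t → t ≤ 2 * q → h (2 * p) ≤ h t := by
  have h1 := hR.interval hnc (q - p).toNat p q hpq (by omega)
    (fun l hl => (hcl p l le_rfl hpq hl).2)
    (fun k l h1 h2 h3 => ⟨Or.inl (hcl k l h1.le h2 h3).1, (hcl k l h1.le h2 h3).2⟩)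
  have h2 := hR.not_down p fun j h2 h3 => by have := hcl p j le_rfl hpq (R.symm h3); omega
  refine ⟨by omega, fun t h3 h4 => ?_⟩
  rcases eq_or_lt_of_le h3 with rfl | h3
  · rfl
  · have := h1.2 t (by omega) h4; omega

theorem IsHeight.ofHeight_eq {R : Setoid ℤ} {h : ℤ → ℤ} (hR : IsHeight R h)
    (hnc : ∀ a b c d, a < b → b < c → c < d → R a c → R b d → R a b) : ofHeight h = R := by
  have key : ∀ n : ℕ, ∀ i j : ℤ, i ≤ j → j - i ≤ n → (ofHeight h i j ↔ R i j) := by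
    intro n
    induction n with
    | zero =>
      intro i j h1 h2
      obtain rfl : i = j := by omega
      exact ⟨fun _ => R.refl i, fun _ => (ofHeight h).refl i⟩
    | succ n ih =>
      intro i j h1 h2
      rcases eq_or_lt_of_le h1 with rfl | h1
      · exact ⟨fun _ => R.refl i, fun _ => (ofHeight h).refl i⟩
      have hstep : ∀ k, i < k → k ≤ j → R i k → (∀ l, i < l → l < k → ¬ R i l) →
          (ofHeight h i j ↔ R i j) := by
        intro k h3 h4 h5 h6
        have h7 := hR.consecutive hnc h3 h5 h6
        have h8 : ofHeight h i k := by
          rw [ofHeight_iff h3.le]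
          refine ⟨h7.1.symm, fun t h9 h10 => ?_⟩
          rcases eq_or_lt_of_le h9 with rfl | h9
          · rfl
          rcases eq_or_lt_of_le h10 with rfl | h10
          · exact h7.1.ge
          · exact (h7.2 t h9 h10).le
        have h9 := ih k j h4 (by omega)
        exact ⟨fun hr => R.trans h5 (h9.1 ((ofHeight h).trans ((ofHeight h).symm h8) hr)),
          fun hr => (ofHeight h).trans h8 (h9.2 (R.trans (R.symm h5) hr))⟩
      by_cases hex : ∃ l, i < l ∧ R i l
      · obtain ⟨l, h3, h4⟩ := hex
        obtain ⟨k, h5, -, h6, h7⟩ := exists_next h3 h4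
        rcases le_or_gt k j with h8 | h8
        · exact hstep k h5 h8 h6 h7
        · refine ⟨fun h9 => ?_, fun h9 => absurd h9 (h7 j h1 h8)⟩
          rw [ofHeight_iff h1.le] at h9
          have := (hR.consecutive hnc h5 h6 h7).2 (2 * j + 1) (by omega) (by omega)
          omega
      · push Not at hex
        refine ⟨fun h9 => ?_, fun h9 => absurd h9 (hex j h1)⟩
        rw [ofHeight_iff h1.le] at h9
        have := h9.2 (2 * i + 2) (by omega) (by omega)
        have := hR.not_up i hex
        omega
  ext i j
  rcases le_total i j with h1 | h1
  · exact key (j - i).toNat i j h1 (by omega)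
  · rw [Setoid.comm' _, key (i - j).toNat j i h1 (by omega), Setoid.comm' _]

theorem periodicNC_rel_add {g : ℤ} (hg : 0 < g) {R : Setoid ℤ} (hR : R ∈ periodicNC g) {i j : ℤ}
    (hij : i + g ≤ j) (h : R i j) : R i (i + g) := by
  rcases eq_or_lt_of_le hij with rfl | hij
  · exact h
  · exact hR.1 i (i + g) j (j + g) (by omega) hij (by omega) h ((hR.2 i j).1 h)

theorem periodicNC_rel_add_mul {g : ℤ} {R : Setoid ℤ} (hR : R ∈ periodicNC g) (i j n : ℤ) :
    R i j ↔ R (i + n * g) (j + n * g) := by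
  induction n with
  | zero => simp
  | succ n ih => rw [ih, hR.2]; ring_nf
  | pred n ih =>
    rw [ih, hR.2 (i + (-n - 1) * g)]; ring_nf

theorem exists_cut {g : ℤ} (hg : 0 < g) {R : Setoid ℤ} (hR : R ∈ periodicNC g)
    (hno : ∀ i, ¬ R i (i + g)) : ∃ p, ∀ k l, k < p → p ≤ l → ¬ R k l := by
  classical
  have hb : ∀ i j, R i j → j < i + g := fun i j h => by
    by_contra h1
    exact hno i (periodicNC_rel_add hg hR (not_lt.1 h1) h)
  let p : ℕ → Prop := fun n => ∃ i, R i (i + n)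
  have hp0 : p 0 := ⟨0, by simp⟩
  have hspec : p (Nat.findGreatest p g.toNat) := Nat.findGreatest_spec (Nat.zero_le _) hp0
  obtain ⟨i, hi⟩ := hspec
  set n := Nat.findGreatest p g.toNat with hn
  have hmax : ∀ k l, R k l → l - k ≤ n := by
    intro k l h
    rcases le_or_gt l k with h1 | h1
    · omega
    have h2 := hb k l h
    have := Nat.le_findGreatest (P := p) (m := (l - k).toNat) (n := g.toNat) (by omega)
      ⟨k, by rwa [show k + ((l - k).toNat : ℤ) = l by omega]⟩
    omega
  refine ⟨i, fun k l h1 h2 h3 => ?_⟩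
  have h4 : ¬ R k i := fun h => by have := hmax k _ (R.trans h hi); omega
  have h5 : ¬ R k (i + n) := fun h => h4 (R.trans h (R.symm hi))
  have h6 : l ≠ i := fun h => h4 (h ▸ h3)
  have h7 : l ≠ i + n := fun h => h5 (h ▸ h3)
  rcases lt_or_gt_of_ne h7 with h8 | h8
  · exact h4 (hR.1 k i l (i + n) h1 (by omega) h8 h3 hi)
  · have := hmax k l h3; omega

theorem surjOn_ofHeight {g : ℤ} (hg : 0 < g) :
    Set.SurjOn ofHeight (periodicWalks g) (periodicNC g) := by
  intro R hR
  obtain ⟨h, h0, hs, hh⟩ := exists_isHeight R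
  have heq := hh.ofHeight_eq hR.1
  refine ⟨h, ⟨h0, hs, ?_⟩, heq⟩
  have hstep : ∀ t, h (t + 2 * g + 1) - h (t + 2 * g) = h (t + 1) - h t := by
    intro t
    rcases Int.even_or_odd' t with ⟨i, rfl | rfl⟩
    · rw [show 2 * i + 2 * g = 2 * (i + g) by ring]
      by_cases h1 : ∃ j, j < i ∧ R j i
      · obtain ⟨j, h2, h3⟩ := h1
        rw [hh.down i j h2 h3, hh.down (i + g) (j + g) (by omega) ((hR.2 _ _).1 h3)]
        ring
      · push Not at h1
        rw [hh.not_down i h1, hh.not_down (i + g) fun j h2 h3 => h1 (j - g) (by omega)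
          ((hR.2 _ _).2 (by simpa using h3))]
        ring
    · rw [show 2 * i + 1 + 2 * g = 2 * (i + g) + 1 by ring, add_assoc, add_assoc]
      by_cases h1 : ∃ j, i < j ∧ R i j
      · obtain ⟨j, h2, h3⟩ := h1
        have h4 := hh.up i j h2 h3
        have h5 := hh.up (i + g) (j + g) (by omega) ((hR.2 _ _).1 h3)
        norm_num
        omega
      · push Not at h1
        have h4 := hh.not_up i h1
        have h5 := hh.not_up (i + g) fun j h2 h3 => h1 (j - g) (by omega)
          ((hR.2 _ _).2 (by simpa using h3))
        norm_num
        omega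
  have hconst : ∃ t, h (t + 2 * g) = h t := by
    by_cases h1 : ∃ i, R i (i + g)
    · obtain ⟨i, hi⟩ := h1
      rw [← heq, ofHeight_iff (by omega)] at hi
      exact ⟨2 * i + 1, by rw [hi.1]; ring_nf⟩
    · push Not at h1
      obtain ⟨p, hp⟩ := exists_cut hg hR h1
      have h2 := hh.excursion hR.1 (p := p) (q := p + g) (by omega) fun k l h2 h3 h4 => by
        refine ⟨?_, ?_⟩
        · by_contra h5
          exact hp l k (by omega) h2 (R.symm h4)
        · by_contra h5
          exact hp (k - g) (l - g) (by omega) (by omega) ((hR.2 _ _).2 (by simpa using h4))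
      exact ⟨2 * p, by rw [← h2.1]; ring_nf⟩
  obtain ⟨t₀, ht₀⟩ := hconst
  have hdiff : (fun t => h (t + t₀ + 2 * g) - h (t₀ + 2 * g)) = fun t => h (t + t₀) - h t₀ := by
    refine eq_of_steps (by simp) fun t => ?_
    have := hstep (t + t₀)
    rw [show t + 1 + t₀ + 2 * g = t + t₀ + 2 * g + 1 by ring,
      show t + 1 + t₀ = t + t₀ + 1 by ring]
    omega
  intro t
  have := congrFun hdiff (t - t₀)
  simp only [sub_add_cancel] at this
  omega

theorem bijOn_ofHeight {g : ℤ} (hg : 0 < g) :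
    Set.BijOn ofHeight (periodicWalks g) (periodicNC g) :=
  ⟨fun _ hh => ofHeight_mem_periodicNC hh.2.2, injOn_ofHeight hg, surjOn_ofHeight hg⟩

theorem isHeight_ofHeight {g : ℤ} (hg : 0 < g) {h : ℤ → ℤ} (hh : h ∈ periodicWalks g) :
    IsHeight (ofHeight h) h := by
  refine ⟨fun i j hj hr => (exists_lt_ofHeight_iff hg hh i).1 ⟨j, hj, hr⟩, fun i hi => ?_,
    fun i j hj hr => by simpa [add_assoc] using (exists_gt_ofHeight_iff hg hh i).1 ⟨j, hj, hr⟩,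
    fun i hi => ?_⟩
  · refine (hh.2.1 (2 * i)).resolve_right fun h1 => ?_
    obtain ⟨j, hj, hr⟩ := (exists_lt_ofHeight_iff hg hh i).2 h1
    exact hi j hj hr
  · rw [show 2 * i + 2 = 2 * i + 1 + 1 by ring]
    refine (hh.2.1 (2 * i + 1)).resolve_left fun h1 => ?_
    obtain ⟨j, hj, hr⟩ := (exists_gt_ofHeight_iff hg hh i).2 h1
    exact hi j hj hr

theorem periodicWalks_add_mul {g : ℤ} {h : ℤ → ℤ} (hh : h ∈ periodicWalks g) (t n : ℤ) :
    h (t + n * (2 * g)) = h t :=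
  (Function.Periodic.int_mul (f := h) hh.2.2 n) t

theorem periodicWalks_emod {g : ℤ} {h : ℤ → ℤ} (hh : h ∈ periodicWalks g) (t : ℤ) :
    h (t % (2 * g)) = h t := by
  rw [← periodicWalks_add_mul hh (t % (2 * g)) (t / (2 * g)), mul_comm (t / (2 * g)),
    Int.emod_add_mul_ediv]

/-- Periodic non-crossing relations none of whose classes straddles a multiple of `g`. -/
def linearNC (g : ℤ) : Set (Setoid ℤ) :=
  {R | R ∈ periodicNC g ∧ ∀ i j, R i j → i / g = j / g}

theorem bijOn_ofHeight_linearNC {g : ℤ} (hg : 0 < g) :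
    Set.BijOn ofHeight {h | h ∈ periodicWalks g ∧ ∀ t, 0 ≤ h t} (linearNC g) := by
  have key : ∀ h ∈ periodicWalks g, (∀ t, 0 ≤ h t) ↔ ofHeight h ∈ linearNC g := by
    intro h hh
    have hpar := height_even hh.1 hh.2.1
    constructor
    · intro hpos
      have hle : ∀ i j, i ≤ j → ofHeight h i j → i / g = j / g := by
        intro i j hij hr
        by_contra hne
        have h1 : i / g < j / g := lt_of_le_of_ne (Int.ediv_le_ediv hg hij) hne
        have h2 : i < j / g * g := (Int.ediv_lt_iff_lt_mul hg).1 h1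
        have h3 : j / g * g ≤ j := Int.ediv_mul_le j hg.ne'
        rw [ofHeight_iff hij] at hr
        have h4 := hr.2 (2 * (j / g * g)) (by omega) (by omega)
        have h5 := periodicWalks_add_mul hh 0 (j / g)
        rw [zero_add, hh.1, mul_left_comm] at h5
        have h6 := hpos (2 * i + 1)
        have h7 := hpar (2 * i + 1)
        omega
      refine ⟨ofHeight_mem_periodicNC hh.2.2, fun i j hr => ?_⟩
      rcases le_total i j with hij | hij
      · exact hle i j hij hr
      · exact (hle j i hij ((ofHeight h).symm hr)).symm
    · intro hR t
      have h1 := (isHeight_ofHeight hg hh).excursion hR.1.1 (p := 0) (q := g) hg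
        fun k l h1 h2 h3 => by
          have h4 := hR.2 k l h3
          rw [Int.ediv_eq_zero_of_lt h1 h2] at h4
          have h5 := Int.emod_add_mul_ediv l g
          rw [← h4, mul_zero, add_zero] at h5
          rw [← h5]
          exact ⟨Int.emod_nonneg _ hg.ne', Int.emod_lt_of_pos _ hg⟩
      rw [mul_zero, hh.1] at h1
      rw [← periodicWalks_emod hh]
      exact h1.2 _ (Int.emod_nonneg _ (by omega)) (Int.emod_lt_of_pos _ (by omega)).le
  refine ⟨fun h hh => (key h hh.1).1 hh.2, (injOn_ofHeight hg).mono fun h hh => hh.1,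
    fun R hR => ?_⟩
  obtain ⟨h, hh, rfl⟩ := surjOn_ofHeight hg hR.1
  exact ⟨h, ⟨hh, (key h hh).2 hR⟩, rfl⟩

theorem ofHeight_reflect_invariant_iff {g : ℤ} (hg : 0 < g) {h : ℤ → ℤ}
    (hh : h ∈ periodicWalks g) :
    (∀ i j, ofHeight h i j ↔ ofHeight h (-1 - i) (-1 - j)) ↔ ∀ t, h (-t) = h t := by
  constructor
  · intro H
    refine congrFun (injOn_ofHeight hg (reflect_mem_periodicWalks hh) hh ?_)
    ext i j
    rw [ofHeight_reflect, ← H]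
  · intro H i j
    rw [← ofHeight_reflect]
    rw [show (fun t => h (-t)) = h from funext H]

/-- Sets of up-steps in `{0, …, n - 1}` whose lattice walk stays nonnegative up to time `n`. -/
def IsBallot (n : ℕ) (S : Finset ℕ) : Prop :=
  ∀ k ≤ n, k ≤ 2 * #{x ∈ S | x < k}

open Classical in
theorem card_ballot_succ {n u : ℕ} (h : n + 1 ≤ 2 * (u + 1)) :
    #{S ∈ powersetCard (u + 1) (range (n + 1)) | IsBallot (n + 1) S} =
      #{S ∈ powersetCard u (range n) | IsBallot n S} +
        #{S ∈ powersetCard (u + 1) (range n) | IsBallot n S} := by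
  rw [range_add_one, powersetCard_succ_insert notMem_range_self, filter_union,
    card_union_of_disjoint, add_comm, filter_image, card_image_of_injOn]
  · have hle : ∀ S ∈ powersetCard u (range n), (IsBallot (n + 1) (insert n S) ↔ IsBallot n S) := by
      intro S hS
      rw [mem_powersetCard] at hS
      have e : ∀ k ≤ n, {x ∈ insert n S | x < k} = {x ∈ S | x < k} := fun k hk => by
        rw [filter_insert, if_neg (by omega)]
      refine ⟨fun H k hk => by rw [← e k hk]; exact H k (by omega), fun H k hk => ?_⟩
      rcases Nat.of_le_succ hk with hk | rfl
      · rw [e k hk]; exact H k hk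
      · rw [filter_true_of_mem, card_insert_of_notMem, hS.2]
        · exact h
        · exact fun h' => by simpa using hS.1 h'
        · intro x hx
          rcases mem_insert.1 hx with rfl | hx
          · simp
          · have := mem_range.1 (hS.1 hx); omega
    have hle' : ∀ S ∈ powersetCard (u + 1) (range n), (IsBallot (n + 1) S ↔ IsBallot n S) := by
      intro S hS
      rw [mem_powersetCard] at hS
      refine ⟨fun H k hk => H k (by omega), fun H k hk => ?_⟩
      rcases Nat.of_le_succ hk with hk | rfl
      · exact H k hk
      · rw [filter_true_of_mem, hS.2]
        · exact h
        · intro x hx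
          have := mem_range.1 (hS.1 hx); omega
    rw [filter_congr hle, filter_congr hle']
  · intro S hS T hT hST
    simp only [coe_filter, mem_powersetCard, Set.mem_ofPred_eq] at hS hT
    have h1 : n ∉ S := fun h' => by simpa using hS.1.1 h'
    have h2 : n ∉ T := fun h' => by simpa using hT.1.1 h'
    rw [← erase_insert h1, hST, erase_insert h2]
  · rw [disjoint_left]
    intro S hS hS'
    simp only [mem_filter, mem_powersetCard, mem_image] at hS hS'
    obtain ⟨⟨T, -, rfl⟩, -⟩ := hS'
    simpa using hS.1.1 (mem_insert_self n T)

theorem not_isBallot_of_card_lt {n : ℕ} {S : Finset ℕ} (h : 2 * #S < n) : ¬ IsBallot n S := by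
  intro H
  have h1 := H n le_rfl
  have h2 := card_filter_le S (fun x => x < n)
  omega

open Classical in
theorem card_ballot (u d : ℕ) (h : d ≤ u + 1) :
    #{S ∈ powersetCard u (range (u + d)) | IsBallot (u + d) S} + (u + d).choose (u + 1) =
      (u + d).choose u := by
  have hedge : ∀ u : ℕ, #{S ∈ powersetCard u (range (u + (u + 1))) | IsBallot (u + (u + 1)) S} +
      (u + (u + 1)).choose (u + 1) = (u + (u + 1)).choose u := fun u => by
    have h1 : {S ∈ powersetCard u (range (u + (u + 1))) | IsBallot (u + (u + 1)) S} = ∅ := by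
      rw [filter_eq_empty_iff]
      intro S hS
      rw [mem_powersetCard] at hS
      exact not_isBallot_of_card_lt (by omega)
    rw [h1, card_empty, zero_add]
    exact Nat.choose_symm_of_eq_add (by omega)
  induction u generalizing d with
  | zero =>
    rcases eq_or_lt_of_le h with rfl | h
    · exact hedge 0
    obtain rfl : d = 0 := by omega
    simp [IsBallot]
  | succ u ih =>
    induction d with
    | zero =>
      simp only [add_zero, Nat.choose_succ_self, Nat.choose_self]
      rw [filter_true_of_mem]
      · simp
      · intro S hS k hk
        rw [mem_powersetCard] at hS
        obtain rfl := eq_of_subset_of_card_le hS.1 (by simp [hS.2])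
        have : {x ∈ range (u + 1) | x < k} = range k := by
          ext x; simp only [mem_filter, mem_range]; omega
        rw [this, card_range]
        omega
    | succ d ihd =>
      rcases eq_or_lt_of_le h with h' | h
      · obtain rfl : d = u + 1 := by omega
        exact hedge (u + 1)
      have h1 := ih (d + 1) (by omega)
      rw [show u + (d + 1) = u + 1 + d by omega] at h1
      have h2 := ihd (by omega)
      rw [← add_assoc, card_ballot_succ (by omega), Nat.choose_succ_succ,
        Nat.choose_succ_succ (u + 1 + d) u]
      simp only [Nat.succ_eq_add_one]
      omega

open Classical in
theorem card_isBallot (p : ℕ) :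
    #{S ∈ (range (2 * p)).powerset | IsBallot (2 * p) S} = (2 * p).choose p := by
  have h1 : ∀ m ≤ p + 1, ∑ j ∈ range m,
      #{S ∈ powersetCard (p + j) (range (2 * p)) | IsBallot (2 * p) S} + (2 * p).choose (p + m) =
        (2 * p).choose p := by
    intro m
    induction m with
    | zero => simp
    | succ m ih =>
      intro hm
      rw [sum_range_succ, ← ih (by omega)]
      have := card_ballot (p + m) (p - m) (by omega)
      rw [show p + m + (p - m) = 2 * p by omega] at this
      rw [← this]
      simp only [add_assoc]
  have h2 := h1 (p + 1) le_rfl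
  rw [Nat.choose_eq_zero_of_lt (by omega : 2 * p < p + (p + 1)), add_zero] at h2
  rw [← h2, card_eq_sum_card_fiberwise (f := fun S => #S - p) (t := range (p + 1))]
  · refine sum_congr rfl fun j hj => ?_
    congr 1
    ext S
    simp only [mem_filter, mem_powerset, mem_powersetCard]
    constructor
    · rintro ⟨⟨h3, h4⟩, h5⟩
      have : ¬ 2 * #S < 2 * p := fun h => not_isBallot_of_card_lt h h4
      exact ⟨⟨h3, by omega⟩, h4⟩
    · rintro ⟨⟨h3, h4⟩, h5⟩
      exact ⟨⟨h3, h5⟩, by omega⟩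
  · intro S hS
    simp only [coe_filter, mem_powerset, Set.mem_ofPred_eq] at hS
    have := card_le_card hS.1
    simp at this ⊢
    omega

/-- The up-steps of a walk among its first `n` steps. -/
def upSteps (n : ℕ) (h : ℤ → ℤ) : Finset ℕ :=
  {k ∈ range n | h (k + 1) = h k + 1}

/-- The height at time `k` of the walk on the natural numbers with set of up-steps `S`. -/
def heightOf (S : Finset ℕ) (k : ℕ) : ℤ := 2 * #{x ∈ S | x < k} - k

theorem filter_lt_succ (S : Finset ℕ) (k : ℕ) :
    #{x ∈ S | x < k + 1} = #{x ∈ S | x < k} + if k ∈ S then 1 else 0 := by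
  have : {x ∈ S | x < k + 1} = {x ∈ S | x < k} ∪ {x ∈ S | x = k} := by
    ext x; simp only [mem_filter, mem_union]
    grind
  rw [this, card_union_of_disjoint]
  · congr 1
    rw [filter_eq']
    split_ifs <;> simp
  · rw [disjoint_filter]
    intros; omega

theorem heightOf_succ (S : Finset ℕ) (k : ℕ) :
    heightOf S (k + 1) = heightOf S k + if k ∈ S then 1 else -1 := by
  rw [heightOf, heightOf, filter_lt_succ]
  split_ifs <;> push_cast <;> ring

theorem heightOf_upSteps {n : ℕ} {h : ℤ → ℤ} (h0 : h 0 = 0)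
    (hs : ∀ t, h (t + 1) = h t + 1 ∨ h (t + 1) = h t - 1) {k : ℕ} (hk : k ≤ n) :
    heightOf (upSteps n h) k = h k := by
  induction k with
  | zero => simp [heightOf, h0]
  | succ k ih =>
    rw [heightOf_succ, ih (by omega)]
    have h1 := hs k
    have h2 : k ∈ upSteps n h ↔ h (k + 1) = h k + 1 := by
      simp only [upSteps, mem_filter, mem_range]
      exact ⟨fun h => h.2, fun h => ⟨by omega, h⟩⟩
    push_cast
    split_ifs with h3
    · rw [h2.1 h3]
    · have := h1.resolve_left fun h4 => h3 (h2.2 h4)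
      rw [this]; ring

theorem isBallot_iff {n : ℕ} {S : Finset ℕ} : IsBallot n S ↔ ∀ k ≤ n, 0 ≤ heightOf S k := by
  refine forall₂_congr fun k _ => ?_
  rw [heightOf]
  omega

/-- Periodic extension of a finite walk. -/
theorem extend_mem_periodicWalks {g : ℕ} (hg : 0 < g) {F : ℕ → ℤ} (h0 : F 0 = 0)
    (h1 : F (2 * g) = 0) (hs : ∀ k < 2 * g, F (k + 1) = F k + 1 ∨ F (k + 1) = F k - 1) :
    (fun t : ℤ => F (t % (2 * g)).toNat) ∈ periodicWalks g := by
  refine ⟨by simpa using h0, fun t => ?_, fun t => by simp⟩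
  have h2 := Int.emod_nonneg t (show (2 * g : ℤ) ≠ 0 by omega)
  have h3 := Int.emod_lt_of_pos t (show (0 : ℤ) < 2 * g by omega)
  have h4 : (t + 1) % (2 * g) = (t % (2 * g) + 1) % (2 * g) := by simp
  have h5 := hs (t % (2 * g)).toNat (by omega)
  simp only
  rw [h4]
  rcases eq_or_lt_of_le (show t % (2 * g) + 1 ≤ 2 * g by omega) with h6 | h6
  · rw [h6]
    rw [show (t % (2 * g)).toNat + 1 = 2 * g by omega, h1] at h5
    simpa [h0] using h5
  · rw [Int.emod_eq_of_lt (by omega) h6, Int.toNat_add (by omega) (by omega)]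
    exact h5

theorem upSteps_eq {n : ℕ} {h : ℤ → ℤ} {S : Finset ℕ} (hS : S ⊆ range n)
    (hh : ∀ k : ℕ, k ≤ n → h k = heightOf S k) : upSteps n h = S := by
  ext k
  simp only [upSteps, mem_filter, mem_range]
  constructor
  · rintro ⟨h1, h2⟩
    rw [hh k (by omega), show ((k : ℤ) + 1) = ((k + 1 : ℕ) : ℤ) by push_cast; rfl,
      hh (k + 1) (by omega), heightOf_succ] at h2
    by_contra h3
    rw [if_neg h3] at h2
    omega
  · intro h1
    have h2 := mem_range.1 (hS h1)
    refine ⟨h2, ?_⟩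
    rw [hh k (by omega), show ((k : ℤ) + 1) = ((k + 1 : ℕ) : ℤ) by push_cast; rfl,
      hh (k + 1) (by omega), heightOf_succ, if_pos h1]

theorem bijOn_upSteps {g : ℕ} (hg : 0 < g) :
    Set.BijOn (upSteps (2 * g)) (periodicWalks g) (powersetCard g (range (2 * g))) := by
  refine ⟨fun h hh => ?_, fun h hh h' hh' he => ?_, fun S hS => ?_⟩
  · have h1 := heightOf_upSteps (n := 2 * g) hh.1 hh.2.1 le_rfl
    have h2 := hh.2.2 0
    rw [zero_add, hh.1] at h2
    push_cast at h1
    have h3 : upSteps (2 * g) h ⊆ range (2 * g) := filter_subset _ _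
    rw [h2, heightOf, filter_true_of_mem (fun x hx => mem_range.1 (h3 hx))] at h1
    push_cast at h1
    exact mem_coe.2 (mem_powersetCard.2 ⟨h3, by omega⟩)
  · funext t
    have h2 := Int.emod_nonneg t (show (2 * g : ℤ) ≠ 0 by omega)
    have h3 := Int.emod_lt_of_pos t (show (0 : ℤ) < 2 * g by omega)
    rw [← periodicWalks_emod hh, ← periodicWalks_emod hh', ← Int.toNat_of_nonneg h2,
      ← heightOf_upSteps (n := 2 * g) hh.1 hh.2.1 (by omega), he,
      heightOf_upSteps (n := 2 * g) hh'.1 hh'.2.1 (by omega)]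
  · have hS' := mem_powersetCard.1 (mem_coe.1 hS)
    have h1 : heightOf S (2 * g) = 0 := by
      rw [heightOf, filter_true_of_mem (fun x hx => mem_range.1 (hS'.1 hx)), hS'.2]
      push_cast; ring
    refine ⟨_, extend_mem_periodicWalks hg (F := heightOf S) (by simp [heightOf]) h1
      fun k _ => ?_, upSteps_eq hS'.1 fun k hk => ?_⟩
    · rw [heightOf_succ]; split_ifs <;> simp [sub_eq_add_neg]
    · rcases eq_or_lt_of_le hk with rfl | hk
      · rw [h1]; simp [heightOf]
      · rw [Int.emod_eq_of_lt (by omega) (by omega)]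
        simp

theorem ncard_periodicWalks {g : ℕ} (hg : 0 < g) :
    (periodicWalks g).ncard = (2 * g).choose g := by
  rw [(bijOn_upSteps hg).ncard_eq, Set.ncard_coe_finset, card_powersetCard, card_range]

theorem nonneg_iff_isBallot {g : ℕ} (hg : 0 < g) {h : ℤ → ℤ} (hh : h ∈ periodicWalks g) :
    (∀ t, 0 ≤ h t) ↔ IsBallot (2 * g) (upSteps (2 * g) h) := by
  rw [isBallot_iff]
  refine ⟨fun H k hk => ?_, fun H t => ?_⟩
  · rw [heightOf_upSteps hh.1 hh.2.1 hk]; exact H _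
  · have h2 := Int.emod_nonneg t (show (2 * g : ℤ) ≠ 0 by omega)
    have h3 := Int.emod_lt_of_pos t (show (0 : ℤ) < 2 * g by omega)
    have := H (t % (2 * g)).toNat (by omega)
    rwa [heightOf_upSteps hh.1 hh.2.1 (by omega), Int.toNat_of_nonneg h2,
      periodicWalks_emod hh] at this

theorem ncard_nonneg_periodicWalks {g : ℕ} (hg : 0 < g) :
    ({h | h ∈ periodicWalks g ∧ ∀ t, 0 ≤ h t}.ncard : ℚ) = 1 / (g + 1) * (2 * g).choose g := by
  classical
  have hb := bijOn_upSteps hg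
  have h1 : Set.BijOn (upSteps (2 * g)) {h | h ∈ periodicWalks g ∧ ∀ t, 0 ≤ h t}
      ({S ∈ powersetCard g (range (2 * g)) | IsBallot (2 * g) S} : Finset _) := by
    refine ⟨fun h hh => ?_, hb.injOn.mono fun h hh => hh.1, fun S hS => ?_⟩
    · exact mem_coe.2 (mem_filter.2 ⟨hb.mapsTo hh.1, (nonneg_iff_isBallot hg hh.1).1 hh.2⟩)
    · have hS' := mem_filter.1 (mem_coe.1 hS)
      obtain ⟨h, hh, rfl⟩ := hb.surjOn (mem_coe.2 hS'.1)
      exact ⟨h, ⟨hh, (nonneg_iff_isBallot hg hh).2 hS'.2⟩, rfl⟩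
  rw [h1.ncard_eq, Set.ncard_coe_finset]
  have h2 := card_ballot g g (by omega)
  rw [← two_mul] at h2
  have h3 := Nat.choose_succ_right_eq (2 * g) g
  rw [show 2 * g - g = g by omega] at h3
  have h4 : (#{S ∈ powersetCard g (range (2 * g)) | IsBallot (2 * g) S} : ℚ) +
    (2 * g).choose (g + 1) = (2 * g).choose g := by exact_mod_cast h2
  have h5 : ((2 * g).choose (g + 1) : ℚ) * (g + 1) = (2 * g).choose g * g := by exact_mod_cast h3
  have h6 : (g + 1 : ℚ) ≠ 0 := by positivity
  field_simp
  linear_combination (g + 1 : ℚ) * h4 - h5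

theorem ncard_even_nonneg_periodicWalks {g : ℕ} (hg : 0 < g) (he : Even g) :
    {h | (h ∈ periodicWalks g ∧ ∀ t, 0 ≤ h t) ∧ ∀ t, h (-t) = h t}.ncard = g.choose (g / 2) := by
  classical
  have h1 : Set.BijOn (upSteps g)
      {h | (h ∈ periodicWalks g ∧ ∀ t, 0 ≤ h t) ∧ ∀ t, h (-t) = h t}
      ({S ∈ (range g).powerset | IsBallot g S} : Finset _) := by
    refine ⟨fun h hh => ?_, fun h hh h' hh' heq => ?_, fun S hS => ?_⟩
    · refine mem_coe.2 (mem_filter.2 ⟨mem_powerset.2 (filter_subset _ _), ?_⟩)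
      rw [isBallot_iff]
      intro k hk
      rw [heightOf_upSteps hh.1.1.1 hh.1.1.2.1 hk]
      exact hh.1.2 _
    · have key : ∀ k : ℕ, k ≤ g → h k = h' k := fun k hk => by
        rw [← heightOf_upSteps hh.1.1.1 hh.1.1.2.1 hk, heq,
          heightOf_upSteps hh'.1.1.1 hh'.1.1.2.1 hk]
      funext t
      have h2 := Int.emod_nonneg t (show (2 * g : ℤ) ≠ 0 by omega)
      have h3 := Int.emod_lt_of_pos t (show (0 : ℤ) < 2 * g by omega)
      rw [← periodicWalks_emod hh.1.1, ← periodicWalks_emod hh'.1.1]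
      rcases le_total (t % (2 * g)) g with h4 | h4
      · rw [← Int.toNat_of_nonneg h2]
        exact key _ (by omega)
      · rw [← hh.2, ← hh'.2, ← hh.1.1.2.2, ← hh'.1.1.2.2,
          ← Int.toNat_of_nonneg (show 0 ≤ -(t % (2 * g)) + 2 * g by omega)]
        exact key _ (by omega)
    · have hS' := mem_filter.1 (mem_coe.1 hS)
      have hsub := mem_powerset.1 hS'.1
      have hpos := isBallot_iff.1 hS'.2
      refine ⟨_, ⟨⟨extend_mem_periodicWalks hg (F := fun k => heightOf S (min k (2 * g - k)))
        (by simp [heightOf]) (by simp [heightOf]) fun k hk => ?_, fun t => ?_⟩, fun t => ?_⟩,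
        upSteps_eq hsub fun k hk => ?_⟩
      · rcases lt_or_ge k g with h2 | h2
        · rw [min_eq_left (by omega), min_eq_left (by omega), heightOf_succ]
          split_ifs <;> simp [sub_eq_add_neg]
        · rw [min_eq_right (by omega), min_eq_right (by omega),
            show 2 * g - k = 2 * g - (k + 1) + 1 by omega, heightOf_succ]
          split_ifs <;> simp
      · exact hpos _ (by omega)
      · have h2 := Int.emod_nonneg t (show (2 * g : ℤ) ≠ 0 by omega)
        have h3 := Int.emod_lt_of_pos t (show (0 : ℤ) < 2 * g by omega)
        rcases eq_or_ne (t % (2 * g)) 0 with h4 | h4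
        · have : (-t) % (2 * g) = 0 := Int.emod_eq_zero_of_dvd
            ((Int.dvd_neg).2 (Int.dvd_of_emod_eq_zero h4))
          simp only [h4, this]
        · have : (-t) % (2 * g) = 2 * g - t % (2 * g) := by
            rw [← Int.emod_eq_of_lt (show 0 ≤ 2 * g - t % (2 * g) by omega)
              (show 2 * g - t % (2 * g) < 2 * g by omega)]
            rw [Int.neg_emod_eq_sub_emod, Int.sub_emod_emod]
          simp only [this]
          congr 1
          omega
      · rw [Int.emod_eq_of_lt (by omega) (by omega), Int.toNat_natCast, min_eq_left (by omega)]
  rw [h1.ncard_eq, Set.ncard_coe_finset]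
  obtain ⟨p, rfl⟩ := he
  rw [← two_mul, card_isBallot, Nat.mul_div_cancel_left _ two_pos]

/-- Equivalence relations on the integers induced by non-crossing equivalence relations on `L`
points arranged on a circle. -/
def cyclicNC (L : ℤ) : Set (Setoid ℤ) :=
  {Q | (∀ i, Q i (i + L)) ∧
    ∀ a b c d, a < b → b < c → c < d → d < a + L → Q a c → Q b d → Q a b}

theorem cyclicNC_add_mul {L : ℤ} {Q : Setoid ℤ} (hQ : ∀ i, Q i (i + L)) (i n : ℤ) :
    Q i (i + n * L) := by
  induction n with
  | zero => simp
  | succ n ih => rw [add_one_mul, ← add_assoc]; exact Q.trans ih (hQ _)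
  | pred n ih =>
    refine Q.trans ih (Q.symm ?_)
    have := hQ (i + (-n - 1) * L)
    rwa [show i + (-(n : ℤ) - 1) * L + L = i + -n * L by ring] at this

theorem cyclicNC_emod {L : ℤ} {Q : Setoid ℤ} (hQ : ∀ i, Q i (i + L)) (i : ℤ) : Q i (i % L) := by
  have := cyclicNC_add_mul hQ (i % L) (i / L)
  rw [mul_comm, Int.emod_add_mul_ediv] at this
  exact Q.symm this

/-- The relation on a circle with `L` points covered by an `L`-periodic relation. -/
def wrap (L : ℤ) (R : Setoid ℤ) (hR : ∀ i j n, R i j ↔ R (i + n * L) (j + n * L)) :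
    Setoid ℤ where
  r i j := ∃ k : ℤ, R i (j + k * L)
  iseqv := by
    refine ⟨fun i => ⟨0, by simp⟩, ?_, ?_⟩
    · rintro i j ⟨k, h⟩
      refine ⟨-k, R.symm ?_⟩
      have := (hR _ _ (-k)).1 h
      rwa [show j + k * L + -k * L = j by ring] at this
    · rintro i j k ⟨m, h1⟩ ⟨n, h2⟩
      refine ⟨n + m, R.trans h1 ?_⟩
      have := (hR _ _ m).1 h2
      rwa [show k + n * L + m * L = k + (n + m) * L by ring] at this

theorem wrap_iff {L : ℤ} {R : Setoid ℤ} {hR : ∀ i j n, R i j ↔ R (i + n * L) (j + n * L)}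
    {i j : ℤ} : wrap L R hR i j ↔ ∃ k : ℤ, R i (j + k * L) := Iff.rfl

section Unbounded

variable {g : ℤ} {R : Setoid ℤ}

theorem rel_add_of_rel (hR : R ∈ periodicNC g) {i j : ℤ}
    (hij : R i j) (hi : R i (i + g)) : R j (j + g) :=
  R.trans (R.symm hij) (R.trans hi ((hR.2 i j).1 hij))

theorem rel_add_mul_of_rel (hR : R ∈ periodicNC g) {i : ℤ} (hi : R i (i + g)) (n : ℤ) :
    R i (i + n * g) := by
  induction n with
  | zero => simp
  | succ n ih =>
    have := (periodicNC_rel_add_mul hR i (i + g) n).1 hi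
    rw [show i + g + n * g = i + (n + 1) * g by ring] at this
    exact R.trans ih this
  | pred n ih =>
    have := (periodicNC_rel_add_mul hR i (i + g) (-n - 1)).1 hi
    rw [show i + g + (-n - 1) * g = i + -n * g by ring] at this
    exact R.trans ih (R.symm this)

theorem rel_add_of_dist (hg : 0 < g) (hR : R ∈ periodicNC g) {i j : ℤ}
    (hij : g ≤ |i - j|) (h : R i j) : R i (i + g) := by
  rcases le_total i j with h1 | h1
  · rw [abs_of_nonpos (by omega)] at hij
    exact periodicNC_rel_add hg hR (by omega) h
  · rw [abs_of_nonneg (by omega)] at hij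
    exact rel_add_of_rel hR (R.symm h) (periodicNC_rel_add hg hR (by omega) (R.symm h))

end Unbounded

section Wrap

variable {g m : ℤ} {R : Setoid ℤ}

theorem periodicNC_rel_wrap (hR : R ∈ periodicNC g) (i j n : ℤ) :
    R i j ↔ R (i + n * (m * g)) (j + n * (m * g)) := by
  rw [← mul_assoc]; exact periodicNC_rel_add_mul hR i j (n * m)

theorem rel_or_of_wrap (hg : 0 < g) (hm : 2 ≤ m) (hR : R ∈ periodicNC g) {i j : ℤ} (hij : i < j)
    (hj : j < i + m * g) (h : wrap (m * g) R (periodicNC_rel_wrap hR) i j) :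
    R i j ∨ R i (j - m * g) := by
  obtain ⟨k, hk⟩ := h
  have hL : 2 * g ≤ m * g := by gcongr
  have hclose : ¬ R i (i + g) → |i - (j + k * (m * g))| < g := fun h1 => by
    by_contra h2
    exact h1 (rel_add_of_dist hg hR (not_lt.1 h2) hk)
  by_cases hi : R i (i + g)
  · left
    have := rel_add_mul_of_rel hR (rel_add_of_rel hR hk hi) (-k * m)
    rw [show j + k * (m * g) + -k * m * g = j by ring] at this
    exact R.trans hk this
  · have h1 := abs_lt.1 (hclose hi)
    rcases lt_trichotomy k 0 with h2 | rfl | h2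
    · rcases eq_or_lt_of_le (show k ≤ -1 by omega) with rfl | h3
      · right; rwa [show j - m * g = j + -1 * (m * g) by ring]
      · have : k * (m * g) ≤ -2 * (m * g) := by gcongr; omega
        omega
    · left; simpa using hk
    · have : 1 * (m * g) ≤ k * (m * g) := by gcongr; omega
      omega

theorem wrap_mem_cyclicNC (hg : 0 < g) (hm : 2 ≤ m) (hR : R ∈ periodicNC g) :
    wrap (m * g) R (periodicNC_rel_wrap hR) ∈ cyclicNC (m * g) := by
  have hL : 2 * g ≤ m * g := by gcongr
  refine ⟨fun i => ⟨-1, by simp⟩, fun a b c d hab hbc hcd hda hac hbd => ?_⟩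
  have h0 : ∀ i j, R i j → wrap (m * g) R (periodicNC_rel_wrap hR) i j :=
    fun i j h => ⟨0, by simpa using h⟩
  have hsub : ∀ i j, R i j → R (i - m * g) (j - m * g) := fun i j h => by
    have := (periodicNC_rel_wrap (m := m) hR i j (-1)).1 h
    rwa [show i + -1 * (m * g) = i - m * g by ring,
      show j + -1 * (m * g) = j - m * g by ring] at this
  rcases rel_or_of_wrap hg hm hR (by omega) (by omega) hac with h1 | h1 <;>
  rcases rel_or_of_wrap hg hm hR (by omega) (by omega) hbd with h2 | h2
  · exact h0 _ _ (hR.1 a b c d hab hbc hcd h1 h2)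
  · have := hR.1 (d - m * g) a b c (by omega) hab hbc (R.symm h2) h1
    exact h0 _ _ (R.trans (R.symm this) (R.symm h2))
  · have := hR.1 (b - m * g) (c - m * g) (d - m * g) a (by omega) (by omega) (by omega)
      (hsub _ _ h2) (R.symm h1)
    exact Setoid.trans' _ hac (Setoid.symm' _ ⟨0, by
      have := (periodicNC_rel_wrap (m := m) hR _ _ 1).1 this
      simpa using this⟩)
  · have := hR.1 (c - m * g) (d - m * g) a b (by omega) (by omega) hab (R.symm h1) (R.symm h2)
    exact h0 _ _ (R.trans h1 (R.trans this (R.symm h2)))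

theorem wrap_periodic (hR : R ∈ periodicNC g) (i j : ℤ) :
    wrap (m * g) R (periodicNC_rel_wrap hR) i j ↔
      wrap (m * g) R (periodicNC_rel_wrap hR) (i + g) (j + g) := by
  simp only [wrap_iff]
  refine exists_congr fun k => ?_
  rw [hR.2, add_right_comm]

theorem rel_iff_wrap (hg : 0 < g) (hm : 2 ≤ m) (hR : R ∈ periodicNC g) (i j : ℤ) :
    R i j ↔ wrap (m * g) R (periodicNC_rel_wrap hR) i j ∧
      (|i - j| < g ∨ wrap (m * g) R (periodicNC_rel_wrap hR) i (i + g)) := by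
  have hL : 2 * g ≤ m * g := by gcongr
  have h0 : ∀ i j, R i j → wrap (m * g) R (periodicNC_rel_wrap hR) i j :=
    fun i j h => ⟨0, by simpa using h⟩
  have hcen : ∀ k, R k (k + g) → ∀ l, wrap (m * g) R (periodicNC_rel_wrap hR) k l → R k l := by
    rintro k hk l ⟨n, hn⟩
    have := rel_add_mul_of_rel hR (rel_add_of_rel hR hn hk) (-n * m)
    rw [show l + n * (m * g) + -n * m * g = l by ring] at this
    exact R.trans hn this
  constructor
  · refine fun h => ⟨h0 _ _ h, ?_⟩
    by_contra! h1
    exact h1.2 (h0 _ _ (rel_add_of_dist hg hR h1.1 h))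
  · rintro ⟨h1, h2 | h2⟩
    · have key : ∀ i j, i < j → j < i + g → wrap (m * g) R (periodicNC_rel_wrap hR) i j →
          R i j := by
        intro i j hij hj h
        rcases rel_or_of_wrap hg hm hR hij (by omega) h with h3 | h3
        · exact h3
        · exact hcen i (rel_add_of_dist hg hR (by rw [abs_of_nonneg (by omega)]; omega) h3) j h
      rw [abs_lt] at h2
      rcases lt_trichotomy i j with h3 | rfl | h3
      · exact key i j h3 (by omega) h1
      · exact R.refl i
      · exact R.symm (key j i h3 (by omega) (Setoid.symm' _ h1))
    · refine hcen i ?_ j h1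
      rcases rel_or_of_wrap hg hm hR (by omega) (by omega) h2 with h3 | h3
      · exact h3
      · exact rel_add_of_dist hg hR (by rw [abs_of_nonneg (by omega)]; omega) h3

end Wrap

section Unroll

variable {g m : ℤ} {Q : Setoid ℤ}

theorem cyclicNC_rel_add (hg : 0 < g) (hQ : Q ∈ cyclicNC (m * g))
    (hp : ∀ i j, Q i j ↔ Q (i + g) (j + g)) {i j : ℤ} (h1 : i + g ≤ j) (h2 : j + g ≤ i + m * g)
    (h : Q i j) : Q i (i + g) := by
  rcases eq_or_lt_of_le h1 with rfl | h1
  · exact h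
  rcases eq_or_lt_of_le h2 with h2 | h2
  · have h3 := hQ.1 i
    rw [← h2] at h3
    exact Q.trans h3 (Q.symm ((hp _ _).1 h))
  · exact hQ.2 i (i + g) j (j + g) (by omega) h1 (by omega) h2 h ((hp _ _).1 h)

theorem rel_add_of_rel' (hp : ∀ i j, Q i j ↔ Q (i + g) (j + g)) {i j : ℤ} (hij : Q i j)
    (hi : Q i (i + g)) : Q j (j + g) :=
  Q.trans (Q.symm hij) (Q.trans hi ((hp i j).1 hij))

theorem dist_lt_of_dist_lt (hm : 2 ≤ m) (hQ : Q ∈ cyclicNC (m * g))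
    (hp : ∀ i j, Q i j ↔ Q (i + g) (j + g)) {i j k : ℤ} (hij : |i - j| < g) (hjk : |j - k| < g)
    (h1 : Q i j) (h2 : Q j k) (hi : ¬ Q i (i + g)) : |i - k| < g := by
  have hg : 0 < g := (abs_nonneg _).trans_lt hij
  have hL : 2 * g ≤ m * g := by gcongr
  have key : ∀ i j k, i < j → j < k → j - i < g → k - j < g → Q i j → Q j k → ¬ Q i (i + g) →
      k - i < g := by
    intro i j k hij hjk hij' hjk' h1 h2 hi
    by_contra! h3
    rcases eq_or_lt_of_le h3 with h3 | h3
    · exact hi (by rw [h3, add_sub_cancel]; exact Q.trans h1 h2)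
    · exact hi (Q.trans h1 (hQ.2 j (i + g) k (j + g) (by omega) (by omega) (by omega) (by omega)
        h2 ((hp _ _).1 h1)))
  by_contra! h3
  rw [abs_lt] at hij hjk
  rcases abs_cases (i - k) with h4 | h4
  · have := key k j i (by omega) (by omega) (by omega) (by omega) (Q.symm h2) (Q.symm h1)
      fun h => hi (rel_add_of_rel' hp (Q.symm (Q.trans h1 h2)) h)
    omega
  · have := key i j k (by omega) (by omega) (by omega) (by omega) h1 h2 hi
    omega

/-- The relation on the integers whose wrapping around the circle is a given relation invariant
under rotation by `g`. -/
def unroll (hm : 2 ≤ m) (hQ : Q ∈ cyclicNC (m * g))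
    (hp : ∀ i j, Q i j ↔ Q (i + g) (j + g)) (hg : 0 < g) : Setoid ℤ where
  r i j := Q i j ∧ (|i - j| < g ∨ Q i (i + g))
  iseqv := by
    refine ⟨fun i => ⟨Q.refl i, Or.inl (by simpa using hg)⟩, ?_, ?_⟩
    · rintro i j ⟨h1, h2⟩
      refine ⟨Q.symm h1, ?_⟩
      rw [abs_sub_comm]
      exact h2.imp_right (rel_add_of_rel' hp h1)
    · rintro i j k ⟨h1, h2⟩ ⟨h3, h4⟩
      refine ⟨Q.trans h1 h3, ?_⟩
      by_cases hi : Q i (i + g)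
      · exact Or.inr hi
      · exact Or.inl (dist_lt_of_dist_lt hm hQ hp (h2.resolve_right hi) (h4.resolve_right
          fun h => hi (rel_add_of_rel' hp (Q.symm h1) h)) h1 h3 hi)

theorem unroll_iff {hm : 2 ≤ m} {hQ : Q ∈ cyclicNC (m * g)}
    {hp : ∀ i j, Q i j ↔ Q (i + g) (j + g)} {hg : 0 < g} {i j : ℤ} :
    unroll hm hQ hp hg i j ↔ Q i j ∧ (|i - j| < g ∨ Q i (i + g)) := Iff.rfl

theorem rel_add_mul_of_rel' (hp : ∀ i j, Q i j ↔ Q (i + g) (j + g)) {i : ℤ}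
    (hi : Q i (i + g)) (n : ℤ) : Q i (i + n * g) := by
  have key : ∀ n : ℤ, Q (i + n * g) (i + (n + 1) * g) := by
    intro n
    induction n with
    | zero => simpa using hi
    | succ n ih =>
      have := (hp _ _).1 ih
      ring_nf at this ⊢
      exact this
    | pred n ih =>
      rw [hp]
      ring_nf at ih ⊢
      exact ih
  induction n with
  | zero => simp
  | succ n ih => exact Q.trans ih (key _)
  | pred n ih =>
    refine Q.trans ih (Q.symm ?_)
    simpa using key (-n - 1)

theorem unroll_mem_periodicNC (hm : 2 ≤ m) (hQ : Q ∈ cyclicNC (m * g))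
    (hp : ∀ i j, Q i j ↔ Q (i + g) (j + g)) (hg : 0 < g) :
    unroll hm hQ hp hg ∈ periodicNC g := by
  have hL : 2 * g ≤ m * g := by gcongr
  refine ⟨fun a b c d hab hbc hcd hac hbd => ?_, fun i j => ?_⟩
  · rw [unroll_iff] at hac hbd ⊢
    obtain ⟨h1, h2⟩ := hac
    obtain ⟨h3, h4⟩ := hbd
    by_cases ha : Q a (a + g)
    · refine ⟨?_, Or.inr ha⟩
      by_cases hb : Q b (b + g)
      · have hb' : Q b (a + (b - a) % g) := by
          have := rel_add_mul_of_rel' hp hb (-((b - a) / g))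
          have e := Int.emod_add_mul_ediv (b - a) g
          rwa [show b + -((b - a) / g) * g = a + (b - a) % g by linarith] at this
        refine Q.trans ?_ (Q.symm hb')
        have h5 := Int.emod_nonneg (b - a) hg.ne'
        have h6 := Int.emod_lt_of_pos (b - a) hg
        rcases eq_or_lt_of_le h5 with h5 | h5
        · rw [← h5, add_zero]
        · exact hQ.2 a (a + (b - a) % g) (a + g) (a + (b - a) % g + g) (by omega) (by omega)
            (by omega) (by omega) ha (rel_add_of_rel' hp hb' hb)
      · have h5 := abs_lt.1 (h4.resolve_right hb)
        have := hQ.2 b c d (c + g) hbc hcd (by omega) (by omega) h3 (rel_add_of_rel' hp h1 ha)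
        exact absurd (rel_add_of_rel' hp (Q.trans h1 (Q.symm this)) ha) hb
    · have h5 := abs_lt.1 (h2.resolve_right ha)
      by_cases hb : Q b (b + g)
      · have := hQ.2 a b c (b + g) hab hbc (by omega) (by omega) h1 hb
        exact absurd (rel_add_of_rel' hp (Q.symm this) hb) ha
      · have h6 := abs_lt.1 (h4.resolve_right hb)
        exact ⟨hQ.2 a b c d hab hbc hcd (by omega) h1 h3, Or.inl (by rw [abs_lt]; omega)⟩
  · rw [unroll_iff, unroll_iff, hp i j, hp i (i + g), add_sub_add_right_eq_sub]

theorem wrap_unroll (hm : 2 ≤ m) (hQ : Q ∈ cyclicNC (m * g))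
    (hp : ∀ i j, Q i j ↔ Q (i + g) (j + g)) (hg : 0 < g) :
    wrap (m * g) (unroll hm hQ hp hg) (periodicNC_rel_wrap (unroll_mem_periodicNC hm hQ hp hg)) =
      Q := by
  have hL : 2 * g ≤ m * g := by gcongr
  ext i j
  rw [wrap_iff]
  constructor
  · rintro ⟨k, hk, -⟩
    exact Q.trans hk (Q.symm (cyclicNC_add_mul hQ.1 j k))
  · intro h
    have h1 := Int.emod_nonneg (j - i) (show m * g ≠ 0 by omega)
    have h2 := Int.emod_lt_of_pos (j - i) (show 0 < m * g by omega)
    have e := Int.emod_add_mul_ediv (j - i) (m * g)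
    have h3 : ∀ k, Q i (j + k * (m * g)) := fun k => Q.trans h (cyclicNC_add_mul hQ.1 j k)
    have e1 : j + -((j - i) / (m * g)) * (m * g) = i + (j - i) % (m * g) := by linarith
    by_cases hi : Q i (i + g)
    · exact ⟨0, h3 0, Or.inr hi⟩
    · by_cases h4 : (j - i) % (m * g) < g
      · refine ⟨-((j - i) / (m * g)), h3 _, Or.inl ?_⟩
        rw [e1, abs_lt]; omega
      · refine ⟨-((j - i) / (m * g)) - 1, h3 _, Or.inl ?_⟩
        rw [sub_mul, ← add_sub_assoc, e1, one_mul, abs_lt]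
        by_contra h5
        refine hi (cyclicNC_rel_add hg hQ hp (j := i + (j - i) % (m * g)) (by omega) (by omega) ?_)
        rw [← e1]; exact h3 _

end Unroll

theorem ncard_cyclicNC_invariant {g : ℤ} (hg : 0 < g) {m : ℤ} (hm : 2 ≤ m) :
    {Q ∈ cyclicNC (m * g) | ∀ i j, Q i j ↔ Q (i + g) (j + g)}.ncard = (periodicNC g).ncard := by
  symm
  refine Set.ncard_congr (fun R hR => wrap (m * g) R (periodicNC_rel_wrap hR)) ?_ ?_ ?_
  · exact fun R hR => ⟨wrap_mem_cyclicNC hg hm hR, wrap_periodic hR⟩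
  · intro R R' hR hR' h
    ext i j
    rw [rel_iff_wrap hg hm hR, rel_iff_wrap hg hm hR', h]
  · rintro Q ⟨hQ, hp⟩
    exact ⟨_, unroll_mem_periodicNC hm hQ hp hg, wrap_unroll hm hQ hp hg⟩

theorem ncard_cyclicNC_invariant' {g : ℕ} (hg : 0 < g) {m : ℕ} (hm : 2 ≤ m) :
    {Q ∈ cyclicNC (m * g : ℕ) | ∀ i j, Q i j ↔ Q (i + g) (j + g)}.ncard = (2 * g).choose g := by
  rw [← ncard_periodicWalks hg, (bijOn_ofHeight (by exact_mod_cast hg)).ncard_eq]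
  have := ncard_cyclicNC_invariant (g := g) (by exact_mod_cast hg) (m := m) (by exact_mod_cast hm)
  exact_mod_cast this

theorem mem_cyclicNC_of_linear {L : ℤ} (hL : 0 < L) {Q : Setoid ℤ} (h1 : ∀ i, Q i (i + L))
    (h2 : ∀ a b c d, 0 ≤ a → a < b → b < c → c < d → d < L → Q a c → Q b d → Q a b) :
    Q ∈ cyclicNC L := by
  refine ⟨h1, ?_⟩
  have key : ∀ a b c d, 0 ≤ a → a < L → a < b → b < c → c < d → d < a + L → Q a c → Q b d →
      Q a b := by
    intro a b c d h0 hL hab hbc hcd hda hac hbd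
    have hs : ∀ i, Q (i - L) i := fun i => by simpa using h1 (i - L)
    by_cases hd : d < L
    · exact h2 a b c d h0 hab hbc hcd hd hac hbd
    have hd' := Q.trans (hs d) (Q.symm hbd)
    by_cases hc : c < L
    · exact Q.trans (Q.symm (h2 (d - L) a b c (by omega) (by omega) hab hbc hc hd' hac)) hd'
    have hc' := Q.trans (hs c) (Q.symm hac)
    by_cases hb : b < L
    · exact Q.trans (Q.symm hc') (Q.trans (h2 (c - L) (d - L) a b (by omega) (by omega) (by omega)
        hab hb hc' hd') hd')
    · have := h2 (b - L) (c - L) (d - L) a (by omega) (by omega) (by omega) (by omega) hL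
        (Q.trans (hs b) (Q.symm hd')) hc'
      exact Q.trans (Q.symm hc') (Q.trans (Q.symm this) (hs b))
  intro a b c d hab hbc hcd hda hac hbd
  have hs : ∀ i, Q i (i + -(a / L) * L) := fun i => cyclicNC_add_mul h1 i _
  have h3 := Int.emod_nonneg a hL.ne'
  have h4 := Int.emod_lt_of_pos a hL
  have h5 : a + -(a / L) * L = a % L := by
    have := Int.emod_add_mul_ediv a L; linarith
  exact Q.trans (hs a) (Q.trans (key _ _ _ _ (by omega) (by omega) (add_lt_add_left hab _)
    (add_lt_add_left hbc _) (add_lt_add_left hcd _) (by omega)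
    (Q.trans (Q.symm (hs a)) (Q.trans hac (hs c))) (Q.trans (Q.symm (hs b)) (Q.trans hbd (hs d))))
    (Q.symm (hs b)))

section Linear

variable {L : ℤ} {Q R : Setoid ℤ}

/-- The restriction of an equivalence relation to the blocks `[n * L, (n + 1) * L)`. -/
def blockwise (L : ℤ) (Q : Setoid ℤ) : Setoid ℤ := Setoid.ker (· / L) ⊓ Q

theorem blockwise_iff {i j : ℤ} : blockwise L Q i j ↔ i / L = j / L ∧ Q i j := Iff.rfl

theorem blockwise_mem_linearNC (hL : 0 < L) (hQ : Q ∈ cyclicNC L) :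
    blockwise L Q ∈ linearNC L := by
  refine ⟨⟨fun a b c d hab hbc hcd hac hbd => ?_, fun i j => ?_⟩, fun i j h => h.1⟩
  · rw [blockwise_iff] at hac hbd ⊢
    have h1 := Int.ediv_le_ediv hL hab.le
    have h2 := Int.ediv_le_ediv hL hbc.le
    have h3 : a / L = b / L := by omega
    refine ⟨h3, hQ.2 a b c d hab hbc hcd ?_ hac.2 hbd.2⟩
    have e1 := Int.emod_add_mul_ediv a L
    have e2 := Int.emod_add_mul_ediv d L
    rw [← hbd.1, ← h3] at e2
    have h3 := Int.emod_nonneg a hL.ne'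
    have h4 := Int.emod_lt_of_pos d hL
    omega
  · rw [blockwise_iff, blockwise_iff, Int.add_ediv_of_dvd_right dvd_rfl,
      Int.add_ediv_of_dvd_right dvd_rfl, add_left_inj]
    refine and_congr_right fun _ => ⟨fun h => ?_, fun h => ?_⟩
    · exact Q.trans (Q.symm (hQ.1 i)) (Q.trans h (hQ.1 j))
    · exact Q.trans (hQ.1 i) (Q.trans h (Q.symm (hQ.1 j)))

theorem cyclicNC_iff_emod (hQ : Q ∈ cyclicNC L) (i j : ℤ) : Q i j ↔ Q (i % L) (j % L) :=
  ⟨fun h => Q.trans (Q.symm (cyclicNC_emod hQ.1 i)) (Q.trans h (cyclicNC_emod hQ.1 j)),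
    fun h => Q.trans (cyclicNC_emod hQ.1 i) (Q.trans h (Q.symm (cyclicNC_emod hQ.1 j)))⟩

theorem blockwise_emod_iff (hL : 0 < L) (hQ : Q ∈ cyclicNC L) (i j : ℤ) :
    blockwise L Q (i % L) (j % L) ↔ Q i j := by
  rw [blockwise_iff, cyclicNC_iff_emod hQ i j, and_iff_right]
  have h : ∀ i, i % L / L = 0 := fun i =>
    Int.ediv_eq_zero_of_lt (Int.emod_nonneg i hL.ne') (Int.emod_lt_of_pos i hL)
  rw [h, h]

theorem bijOn_blockwise (hL : 0 < L) : Set.BijOn (blockwise L) (cyclicNC L) (linearNC L) := by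
  refine ⟨fun Q hQ => blockwise_mem_linearNC hL hQ, fun Q hQ Q' hQ' h => ?_, fun R hR => ?_⟩
  · ext i j
    rw [← blockwise_emod_iff hL hQ, ← blockwise_emod_iff hL hQ', h]
  · refine ⟨R.comap (· % L), mem_cyclicNC_of_linear hL (fun i => ?_) ?_, ?_⟩
    · simp [Setoid.comap_rel]
    · intro a b c d h0 hab hbc hcd hd hac hbd
      simp only [Setoid.comap_rel] at hac hbd ⊢
      rw [Int.emod_eq_of_lt (by omega) (by omega)] at *
      rw [Int.emod_eq_of_lt (by omega) (by omega)] at *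
      exact hR.1.1 a b c d hab hbc hcd hac hbd
    · ext i j
      rw [blockwise_iff, Setoid.comap_rel]
      have key : i / L = j / L → (R (i % L) (j % L) ↔ R i j) := by
        intro h
        rw [periodicNC_rel_add_mul hR.1 (i % L) (j % L) (i / L)]
        nth_rw 2 [h]
        rw [mul_comm, Int.emod_add_mul_ediv, mul_comm, Int.emod_add_mul_ediv]
      exact ⟨fun h => (key h.1).1 h.2, fun h => ⟨hR.2 i j h, (key (hR.2 i j h)).2 h⟩⟩

theorem reflect_ediv (hL : 0 < L) (i : ℤ) : (-1 - i) / L = -1 - i / L := by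
  have h := Int.emod_add_mul_ediv i L
  have h3 := Int.emod_nonneg i hL.ne'
  have h4 := Int.emod_lt_of_pos i hL
  refine ((Int.ediv_emod_unique (r := L - 1 - i % L) hL).2 ⟨?_, by omega, by omega⟩).1
  linarith [mul_sub L (-1) (i / L)]

theorem blockwise_reflect_iff (hL : 0 < L) (hQ : Q ∈ cyclicNC L) :
    (∀ i j, blockwise L Q i j ↔ blockwise L Q (-1 - i) (-1 - j)) ↔
      ∀ i j, Q i j ↔ Q (-1 - i) (-1 - j) := by
  have e : ∀ i, (-1 - i) % L = -1 - (i % L) + L := fun i => by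
    have h := Int.emod_add_mul_ediv i L
    have h' := Int.emod_add_mul_ediv (-1 - i) L
    rw [reflect_ediv hL, mul_sub] at h'
    linarith
  constructor
  · intro h i j
    rw [← blockwise_emod_iff hL hQ, h, ← blockwise_emod_iff hL hQ (-1 - i), e, e,
      (blockwise_mem_linearNC hL hQ).1.2]
  · intro h i j
    rw [blockwise_iff, blockwise_iff, ← h, reflect_ediv hL, reflect_ediv hL, sub_right_inj]

theorem ncard_cyclicNC {L : ℕ} (hL : 0 < L) :
    ((cyclicNC L).ncard : ℚ) = 1 / (L + 1) * (2 * L).choose L := by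
  have hL' : (0 : ℤ) < L := by exact_mod_cast hL
  rw [← ncard_nonneg_periodicWalks hL, (bijOn_blockwise hL').ncard_eq,
    (bijOn_ofHeight_linearNC hL').ncard_eq]

theorem ncard_cyclicNC_reflect {L : ℕ} (hL : 0 < L) (he : Even L) :
    {Q ∈ cyclicNC L | ∀ i j, Q i j ↔ Q (-1 - i) (-1 - j)}.ncard = L.choose (L / 2) := by
  have hL' : (0 : ℤ) < L := by exact_mod_cast hL
  rw [← ncard_even_nonneg_periodicWalks hL he]
  have h1 := ((bijOn_blockwise hL').injOn.mono (Set.sep_subset _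
    fun Q => ∀ i j, Q i j ↔ Q (-1 - i) (-1 - j))).ncard_image
  have h2 := ((bijOn_ofHeight_linearNC hL').injOn.mono (Set.sep_subset _
    fun h => ∀ t, h (-t) = h t)).ncard_image
  refine h1.symm.trans (Eq.trans ?_ h2)
  congr 1
  ext R
  constructor
  · rintro ⟨Q, ⟨hQ, hi⟩, rfl⟩
    obtain ⟨h, hh, e⟩ := (bijOn_ofHeight_linearNC hL').surjOn (blockwise_mem_linearNC hL' hQ)
    refine ⟨h, ⟨hh, (ofHeight_reflect_invariant_iff hL' hh.1).1 ?_⟩, e⟩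
    rw [e]
    exact (blockwise_reflect_iff hL' hQ).2 hi
  · rintro ⟨h, ⟨hh, hi⟩, rfl⟩
    obtain ⟨Q, hQ, e⟩ := (bijOn_blockwise hL').surjOn ((bijOn_ofHeight_linearNC hL').mapsTo hh)
    refine ⟨Q, ⟨hQ, (blockwise_reflect_iff hL' hQ).1 ?_⟩, e⟩
    rw [e]
    exact (ofHeight_reflect_invariant_iff hL' hh.1).2 hi

end Linear

section Burnside

open MulAction

theorem ncard_orbit_image_mul_card {G α : Type*} [Group G] [Fintype G] [MulAction G α] [Finite α]
    {s : Set α} (hs : ∀ g : G, ∀ x ∈ s, g • x ∈ s) :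
    (orbit G '' s).ncard * Fintype.card G = ∑ g : G, {x ∈ s | g • x = x}.ncard := by
  classical
  let X : SubMulAction G α := ⟨s, fun g {x} hx => hs g x hx⟩
  have : Finite X := Subtype.finite
  have : Fintype X := Fintype.ofFinite _
  have : Fintype (Quotient (orbitRel G X)) := Fintype.ofFinite _
  have h1 : (orbit G '' s).ncard = Fintype.card (Quotient (orbitRel G X)) := by
    rw [← Nat.card_coe_set_eq, ← Nat.card_eq_fintype_card]
    symm
    have key : ∀ x y : X, orbitRel G X x y ↔ orbit G (x : α) = orbit G (y : α) := by
      intro x y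
      rw [orbitRel_apply, orbit_eq_iff]
      exact exists_congr fun g => by rw [Subtype.ext_iff]; rfl
    refine Nat.card_eq_of_bijective (Quotient.lift
      (fun x : X => (⟨orbit G (x : α), x, x.2, rfl⟩ : (orbit G '' s : Set (Set α))))
      fun x y h => Subtype.ext ((key x y).1 h)) ⟨?_, ?_⟩
    · rintro ⟨x⟩ ⟨y⟩ h
      exact Quotient.sound ((key x y).2 (congrArg Subtype.val h))
    · rintro ⟨_, x, hx, rfl⟩
      exact ⟨Quotient.mk _ ⟨x, hx⟩, rfl⟩
  rw [h1, ← sum_card_fixedBy_eq_card_orbits_mul_card_group G X]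
  refine Finset.sum_congr rfl fun g _ => ?_
  rw [← Nat.card_eq_fintype_card, ← Nat.card_coe_set_eq]
  refine Nat.card_congr ⟨fun x => ⟨x.1.1, x.1.2, congrArg Subtype.val x.2⟩,
    fun x => ⟨⟨x.1, x.2.1⟩, Subtype.ext x.2.2⟩, fun _ => rfl, fun _ => rfl⟩

end Burnside

/-- Permutations act on equivalence relations by transport. -/
instance permMulActionSetoid (α : Type*) : MulAction (Equiv.Perm α) (Setoid α) where
  smul σ S := S.comap ⇑σ⁻¹
  one_smul _ := rfl
  mul_smul σ σ' S := by
    change S.comap ⇑(σ * σ')⁻¹ = (S.comap ⇑σ'⁻¹).comap ⇑σ⁻¹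
    rw [mul_inv_rev]; rfl

theorem perm_smul_iff {α : Type*} (σ : Equiv.Perm α) (S : Setoid α) (i j : α) :
    (σ • S) i j ↔ S (σ⁻¹ i) (σ⁻¹ j) := Iff.rfl

theorem perm_smul_eq_self_iff {α : Type*} (σ : Equiv.Perm α) (S : Setoid α) :
    σ • S = S ↔ ∀ i j, S i j ↔ S (σ i) (σ j) := by
  constructor
  · intro h i j
    conv_rhs => rw [← h]
    simp [perm_smul_iff]
  · intro h
    ext i j
    rw [perm_smul_iff, h]
    simp

section Partition

variable {L : ℕ}

/-- The equivalence relation whose classes are the blocks of a partition. -/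
def blockRel (P : Finpartition (univ : Finset (Fin L))) : Setoid (Fin L) := Setoid.ker P.part

theorem blockRel_iff_mem_part {P : Finpartition (univ : Finset (Fin L))} {i j : Fin L} :
    blockRel P i j ↔ i ∈ P.part j :=
  (P.mem_part_iff_part_eq_part (mem_univ _) (mem_univ _)).symm

theorem blockRel_iff {P : Finpartition (univ : Finset (Fin L))} {i j : Fin L} :
    blockRel P i j ↔ ∃ B ∈ P.parts, i ∈ B ∧ j ∈ B := by
  rw [blockRel_iff_mem_part, P.mem_part_iff_exists]

theorem parts_eq_image_part (P : Finpartition (univ : Finset (Fin L))) :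
    P.parts = univ.image P.part := by
  ext B
  rw [mem_image]
  constructor
  · intro hB
    obtain ⟨x, hx⟩ := P.nonempty_of_mem_parts hB
    exact ⟨x, mem_univ _, P.part_eq_of_mem hB hx⟩
  · rintro ⟨x, -, rfl⟩
    exact P.part_mem.2 (mem_univ _)

theorem blockRel_bijective :
    Function.Bijective (blockRel : Finpartition (univ : Finset (Fin L)) → Setoid (Fin L)) := by
  classical
  refine ⟨fun P Q h => ?_, fun S => ⟨Finpartition.ofSetoid S, ?_⟩⟩
  · apply Finpartition.ext
    rw [parts_eq_image_part, parts_eq_image_part]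
    congr 1
    ext x y
    rw [← blockRel_iff_mem_part, ← blockRel_iff_mem_part, h]
  · ext i j
    rw [blockRel_iff_mem_part, Finpartition.mem_part_ofSetoid_iff_rel, Setoid.comm']

theorem parts_eq_permParts_iff (σ : Equiv.Perm (Fin L))
    (P Q : Finpartition (univ : Finset (Fin L))) :
    Q.parts = permParts σ P ↔ blockRel Q = σ • blockRel P := by
  have hmem : ∀ (B : Finset (Fin L)) i, i ∈ B.image σ ↔ σ⁻¹ i ∈ B := fun B i => by
    rw [mem_image]
    exact ⟨by rintro ⟨x, hx, rfl⟩; simpa using hx, fun h => ⟨_, h, by simp⟩⟩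
  constructor
  · intro h
    ext i j
    rw [perm_smul_iff, blockRel_iff, blockRel_iff, h]
    simp only [permParts, exists_mem_image, hmem]
  · intro h
    have key : ∀ x, Q.part (σ x) = (P.part x).image σ := fun x => by
      ext y
      rw [← blockRel_iff_mem_part, h, perm_smul_iff, hmem, ← blockRel_iff_mem_part]
      simp
    rw [permParts, parts_eq_image_part, parts_eq_image_part, image_image]
    ext B
    simp only [mem_image, mem_univ, true_and, Function.comp, ← key]
    exact (σ.surjective.exists (p := fun x => Q.part x = B))

theorem ncard_orbitSet_image (H : Subgroup (Equiv.Perm (Fin L)))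
    (s : Set (Finpartition (univ : Finset (Fin L)))) :
    (orbitSet H '' s).ncard = (MulAction.orbit H '' (blockRel '' s)).ncard := by
  have h : orbitSet H = Set.preimage blockRel ∘ MulAction.orbit H ∘ blockRel := by
    funext P
    ext Q
    simp only [orbitSet, parts_eq_permParts_iff, Function.comp, Set.mem_preimage,
      MulAction.mem_orbit_iff, Subtype.exists, Set.mem_ofPred_eq]
    exact exists_congr fun σ => ⟨fun ⟨h1, h2⟩ => ⟨h1, h2.symm⟩, fun ⟨h1, h2⟩ => ⟨h1, h2.symm⟩⟩
  rw [h, Set.image_comp, Set.image_comp]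
  exact Set.ncard_image_of_injective _ (Set.preimage_injective.2 blockRel_bijective.2)

/-- Non-crossing equivalence relations on `L` points. -/
def finNC (L : ℕ) : Set (Setoid (Fin L)) :=
  {S | ∀ a b c d, a < b → b < c → c < d → S a c → S b d → S a b}

theorem blockRel_mem_finNC_iff (P : Finpartition (univ : Finset (Fin L))) :
    blockRel P ∈ finNC L ↔ NonCrossing P := by
  constructor
  · rintro h ⟨a, b, c, d, hab, hbc, hcd, B₁, h1, B₂, h2, hne, ha, hc, hb, hd⟩
    have := h a b c d hab hbc hcd (blockRel_iff.2 ⟨B₁, h1, ha, hc⟩) (blockRel_iff.2 ⟨B₂, h2, hb, hd⟩)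
    obtain ⟨B, hB, ha', hb'⟩ := blockRel_iff.1 this
    exact hne ((P.eq_of_mem_parts h1 hB ha ha').trans (P.eq_of_mem_parts h2 hB hb hb').symm)
  · intro h a b c d hab hbc hcd hac hbd
    obtain ⟨B₁, h1, ha, hc⟩ := blockRel_iff.1 hac
    obtain ⟨B₂, h2, hb, hd⟩ := blockRel_iff.1 hbd
    by_cases hB : B₁ = B₂
    · exact blockRel_iff.2 ⟨B₁, h1, ha, hB ▸ hb⟩
    · exact absurd ⟨a, b, c, d, hab, hbc, hcd, B₁, h1, B₂, h2, hB, ha, hc, hb, hd⟩ h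

theorem image_blockRel_nonCrossing :
    blockRel '' {P : Finpartition (univ : Finset (Fin L)) | NonCrossing P} = finNC L := by
  ext S
  obtain ⟨P, rfl⟩ := blockRel_bijective.2 S
  rw [blockRel_bijective.1.mem_set_image, blockRel_mem_finNC_iff]
  rfl

end Partition

section Circle

variable {L : ℕ}

/-- The `L`-periodic projection from the integers to `L` points. -/
def circleProj (hL : 0 < L) (i : ℤ) : Fin L :=
  ⟨(i % L).toNat, by have := Int.emod_lt_of_pos i (show (0 : ℤ) < L by omega); omega⟩

theorem coe_circleProj (hL : 0 < L) (i : ℤ) : ((circleProj hL i : ℕ) : ℤ) = i % L :=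
  Int.toNat_of_nonneg (Int.emod_nonneg i (by omega))

theorem circleProj_coe (hL : 0 < L) (x : Fin L) : circleProj hL (x : ℕ) = x := by
  rw [Fin.ext_iff, ← Nat.cast_inj (R := ℤ), coe_circleProj]
  exact Int.emod_eq_of_lt (by omega) (by omega)

theorem circleProj_eq_iff (hL : 0 < L) {i j : ℤ} :
    circleProj hL i = circleProj hL j ↔ i % L = j % L := by
  rw [Fin.ext_iff, ← Nat.cast_inj (R := ℤ), coe_circleProj, coe_circleProj]

theorem circleProj_surjective (hL : 0 < L) : Function.Surjective (circleProj hL) :=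
  fun x => ⟨_, circleProj_coe hL x⟩

theorem bijOn_comap_circleProj (hL : 0 < L) :
    Set.BijOn (Setoid.comap (circleProj hL)) (finNC L) (cyclicNC L) := by
  have hL' : (0 : ℤ) < L := by exact_mod_cast hL
  refine ⟨fun S hS => mem_cyclicNC_of_linear hL' (fun i => ?_) ?_, fun S _ T _ h => ?_,
    fun Q hQ => ⟨Q.comap fun x : Fin L => ((x : ℕ) : ℤ), ?_, ?_⟩⟩
  · rw [Setoid.comap_rel, (circleProj_eq_iff hL).2 (Int.add_emod_right i L).symm]
  · intro a b c d h0 hab hbc hcd hd hac hbd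
    have hlt : ∀ i j : ℤ, 0 ≤ i → i < j → j < L → circleProj hL i < circleProj hL j := by
      intro i j h1 h2 h3
      rw [Fin.lt_def, ← Nat.cast_lt (α := ℤ), coe_circleProj, coe_circleProj,
        Int.emod_eq_of_lt h1 (by omega), Int.emod_eq_of_lt (by omega) h3]
      exact h2
    exact hS _ _ _ _ (hlt a b (by omega) hab (by omega)) (hlt b c (by omega) hbc (by omega))
      (hlt c d (by omega) hcd (by omega)) hac hbd
  · ext x y
    rw [← circleProj_coe hL x, ← circleProj_coe hL y, ← Setoid.comap_rel (circleProj hL) S, h,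
      Setoid.comap_rel]
  · exact fun a b c d hab hbc hcd hac hbd =>
      hQ.2 a b c d (by exact_mod_cast hab) (by exact_mod_cast hbc) (by exact_mod_cast hcd)
        (by omega) hac hbd
  · ext i j
    rw [Setoid.comap_rel, Setoid.comap_rel, coe_circleProj, coe_circleProj, ← cyclicNC_iff_emod hQ]

theorem ncard_finNC_fixed (hL : 0 < L) {σ : Equiv.Perm (Fin L)} {f : ℤ → ℤ}
    (hf : ∀ i, σ (circleProj hL i) = circleProj hL (f i)) :
    {S ∈ finNC L | σ • S = S}.ncard =
      {Q ∈ cyclicNC L | ∀ i j, Q i j ↔ Q (f i) (f j)}.ncard := by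
  have h1 := ((bijOn_comap_circleProj hL).injOn.mono (Set.sep_subset _
    fun S => σ • S = S)).ncard_image
  rw [← h1]
  congr 1
  have key : ∀ S : Setoid (Fin L), (∀ i j, S.comap (circleProj hL) i j ↔
      S.comap (circleProj hL) (f i) (f j)) ↔ σ • S = S := by
    intro S
    rw [perm_smul_eq_self_iff, (circleProj_surjective hL).forall₂]
    simp only [Setoid.comap_rel, hf]
  ext Q
  constructor
  · rintro ⟨S, ⟨hS, h⟩, rfl⟩
    exact ⟨(bijOn_comap_circleProj hL).mapsTo hS, (key S).2 h⟩
  · rintro ⟨hQ, h⟩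
    obtain ⟨S, hS, rfl⟩ := (bijOn_comap_circleProj hL).surjOn hQ
    exact ⟨S, ⟨hS, (key S).1 h⟩, rfl⟩

end Circle

section Symmetry

variable {L : ℤ} {Q : Setoid ℤ}

theorem comap_add_mem_cyclicNC (hQ : Q ∈ cyclicNC L) (n : ℤ) :
    Q.comap (fun i => i + n) ∈ cyclicNC L := by
  refine ⟨fun i => ?_, fun a b c d hab hbc hcd hda hac hbd => ?_⟩
  · rw [Setoid.comap_rel, add_right_comm]
    exact hQ.1 _
  · exact hQ.2 (a + n) (b + n) (c + n) (d + n) (by omega) (by omega) (by omega) (by omega) hac hbd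

theorem comap_sub_mem_cyclicNC (hQ : Q ∈ cyclicNC L) (n : ℤ) :
    Q.comap (fun i => n - i) ∈ cyclicNC L := by
  refine ⟨fun i => ?_, fun a b c d hab hbc hcd hda hac hbd => ?_⟩
  · rw [Setoid.comap_rel]
    have := hQ.1 (n - (i + L))
    rw [show n - (i + L) + L = n - i by ring] at this
    exact Q.symm this
  · rw [Setoid.comap_rel] at hac hbd ⊢
    have := hQ.2 (n - d) (n - c) (n - b) (n - a) (by omega) (by omega) (by omega) (by omega)
      (Q.symm hbd) (Q.symm hac)
    exact Q.trans hac (Q.trans (Q.symm this) (Q.symm hbd))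

theorem ncard_cyclicNC_reflect_sub {L n : ℕ} (hL : 0 < L) (he : Even L) :
    {Q ∈ cyclicNC L | ∀ i j, Q i j ↔ Q (2 * n - 1 - i) (2 * n - 1 - j)}.ncard =
      L.choose (L / 2) := by
  rw [← ncard_cyclicNC_reflect hL he]
  refine Set.ncard_congr (fun Q _ => Q.comap (fun i => i + n)) ?_ ?_ ?_
  · rintro Q ⟨hQ, h⟩
    refine ⟨comap_add_mem_cyclicNC hQ n, fun i j => ?_⟩
    simp only [Setoid.comap_rel]
    rw [h]
    ring_nf
  · intro Q Q' _ _ h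
    ext i j
    have := congrArg (fun S : Setoid ℤ => S (i - n) (j - n)) h
    simpa [Setoid.comap_rel] using this
  · rintro Q ⟨hQ, h⟩
    refine ⟨Q.comap (fun i => i + -n), ⟨comap_add_mem_cyclicNC hQ _, fun i j => ?_⟩, ?_⟩
    · simp only [Setoid.comap_rel]
      rw [h]
      ring_nf
    · ext i j
      simp [Setoid.comap_rel]

theorem invariant_add_mul {a : ℤ} (h : ∀ i j, Q i j ↔ Q (i + a) (j + a)) (n i j : ℤ) :
    Q i j ↔ Q (i + n * a) (j + n * a) := by
  induction n with
  | zero => simp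
  | succ n ih => rw [ih, h, add_one_mul, add_assoc, add_assoc]
  | pred n ih => rw [ih, h (i + (-n - 1) * a)]; ring_nf

theorem invariant_gcd_iff (hQ : Q ∈ cyclicNC L) (a : ℤ) :
    (∀ i j, Q i j ↔ Q (i + a) (j + a)) ↔ ∀ i j, Q i j ↔ Q (i + Int.gcd L a) (j + Int.gcd L a) := by
  constructor
  · intro h i j
    rw [invariant_add_mul h (Int.gcdB L a), Int.gcd_eq_gcd_ab L a, mul_comm L, mul_comm a,
      add_comm (_ * L), ← add_assoc, ← add_assoc]
    have key : ∀ i, Q i (i + Int.gcdA L a * L) := fun i => cyclicNC_add_mul hQ.1 i _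
    exact ⟨fun H => Q.trans (Q.symm (key _)) (Q.trans H (key _)),
      fun H => Q.trans (key _) (Q.trans H (Q.symm (key _)))⟩
  · intro h i j
    obtain ⟨c, hc⟩ := Int.gcd_dvd_right L a
    rw [invariant_add_mul h c, mul_comm c, ← hc]

theorem ncard_cyclicNC_rotate {n k : ℕ} (hk : 0 < k) (hkn : k < n) :
    {Q ∈ cyclicNC (2 * n : ℕ) | ∀ i j, Q i j ↔ Q (i + 2 * k) (j + 2 * k)}.ncard =
      (2 * (2 * n.gcd k)).choose (2 * n.gcd k) := by
  have hg : 0 < n.gcd k := Nat.gcd_pos_of_pos_right _ hk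
  obtain ⟨m, hm⟩ := n.gcd_dvd_left k
  have hm2 : 2 ≤ m := by
    by_contra! h
    have : n.gcd k ≤ k := Nat.gcd_le_right _ hk
    interval_cases m <;> omega
  rw [← ncard_cyclicNC_invariant' (g := 2 * n.gcd k) (by omega) hm2]
  have e : 2 * n = m * (2 * n.gcd k) := by rw [mul_left_comm, mul_comm m, ← hm]
  rw [← e]
  congr 1
  ext Q
  refine and_congr_right fun hQ => ?_
  have := invariant_gcd_iff hQ ((2 * k : ℕ) : ℤ)
  rw [Int.gcd_natCast_natCast, Nat.gcd_mul_left] at this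
  simpa using this

end Symmetry

section Group

variable {L n : ℕ} {ρ τ : Equiv.Perm (Fin L)}

theorem lift_rotate (hL : 0 < L) (hρ : ∀ i : Fin L, (ρ i : ℕ) = ((i : ℕ) + 2) % L) (i : ℤ) :
    ρ (circleProj hL i) = circleProj hL (i + 2) := by
  rw [Fin.ext_iff, hρ, ← Nat.cast_inj (R := ℤ), coe_circleProj]
  push_cast
  rw [coe_circleProj, Int.emod_add_emod]

theorem lift_rotate_pow (hL : 0 < L) (hρ : ∀ i : Fin L, (ρ i : ℕ) = ((i : ℕ) + 2) % L) (k : ℕ)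
    (i : ℤ) : (ρ ^ k) (circleProj hL i) = circleProj hL (i + 2 * k) := by
  induction k generalizing i with
  | zero => simp
  | succ k ih =>
    rw [pow_succ, Equiv.Perm.mul_apply, lift_rotate hL hρ, ih]
    push_cast
    ring_nf

theorem lift_reflect (hL : 0 < L) (hτ : ∀ i : Fin L, (τ i : ℕ) = L - 1 - (i : ℕ)) (i : ℤ) :
    τ (circleProj hL i) = circleProj hL (-1 - i) := by
  have h := coe_circleProj hL i
  have h1 := (circleProj hL i).2
  have e : ((τ (circleProj hL i) : ℕ) : ℤ) = L - 1 - i % L := by rw [hτ]; omega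
  rw [Fin.ext_iff, ← Nat.cast_inj (R := ℤ), e, coe_circleProj]
  have h2 := Int.emod_add_mul_ediv i L
  rw [← Int.emod_eq_of_lt (a := L - 1 - i % L) (b := L) (by omega) (by omega)]
  rw [show (-1 : ℤ) - i = L - 1 - i % L + L * (-1 - i / L) by rw [mul_sub]; linarith,
    Int.add_mul_emod_self_left]

theorem lift_rotate_pow_mul_reflect (hL : 0 < L)
    (hρ : ∀ i : Fin L, (ρ i : ℕ) = ((i : ℕ) + 2) % L)
    (hτ : ∀ i : Fin L, (τ i : ℕ) = L - 1 - (i : ℕ)) (k : ℕ) (i : ℤ) :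
    (ρ ^ k * τ) (circleProj hL i) = circleProj hL (2 * k - 1 - i) := by
  rw [Equiv.Perm.mul_apply, lift_reflect hL hτ, lift_rotate_pow hL hρ]
  ring_nf

theorem exists_lift_of_mem_closure (hL : 0 < L)
    (hρ : ∀ i : Fin L, (ρ i : ℕ) = ((i : ℕ) + 2) % L)
    (hτ : ∀ i : Fin L, (τ i : ℕ) = L - 1 - (i : ℕ)) {σ : Equiv.Perm (Fin L)}
    (hσ : σ ∈ Subgroup.closure {ρ, τ}) :
    ∃ k : ℤ, (∀ i, σ (circleProj hL i) = circleProj hL (i + 2 * k)) ∨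
      ∀ i, σ (circleProj hL i) = circleProj hL (2 * k - 1 - i) := by
  induction hσ using Subgroup.closure_induction with
  | mem σ h =>
    rcases h with rfl | rfl
    · exact ⟨1, Or.inl fun i => by simpa using lift_rotate hL hρ i⟩
    · exact ⟨0, Or.inr fun i => by simpa using lift_reflect hL hτ i⟩
  | one => exact ⟨0, Or.inl fun i => by simp⟩
  | mul σ σ' _ _ h h' =>
    obtain ⟨k, h⟩ := h
    obtain ⟨k', h'⟩ := h'
    rcases h with h | h <;> rcases h' with h' | h'
    · exact ⟨k + k', Or.inl fun i => by rw [Equiv.Perm.mul_apply, h', h]; ring_nf⟩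
    · exact ⟨k + k', Or.inr fun i => by rw [Equiv.Perm.mul_apply, h', h]; ring_nf⟩
    · exact ⟨k - k', Or.inr fun i => by rw [Equiv.Perm.mul_apply, h', h]; ring_nf⟩
    · exact ⟨k - k', Or.inl fun i => by rw [Equiv.Perm.mul_apply, h', h]; ring_nf⟩
  | inv σ _ h =>
    obtain ⟨k, h | h⟩ := h
    · exact ⟨-k, Or.inl fun i => by rw [Equiv.Perm.inv_eq_iff_eq, h]; ring_nf⟩
    · exact ⟨k, Or.inr fun i => by rw [Equiv.Perm.inv_eq_iff_eq, h]; ring_nf⟩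

theorem smul_mem_finNC (hL : 0 < L) (hρ : ∀ i : Fin L, (ρ i : ℕ) = ((i : ℕ) + 2) % L)
    (hτ : ∀ i : Fin L, (τ i : ℕ) = L - 1 - (i : ℕ)) {σ : Equiv.Perm (Fin L)}
    (hσ : σ ∈ Subgroup.closure {ρ, τ}) {S : Setoid (Fin L)} (hS : S ∈ finNC L) :
    σ • S ∈ finNC L := by
  have key : (σ • S).comap (circleProj hL) ∈ cyclicNC L := by
    have hS' := (bijOn_comap_circleProj hL).mapsTo hS
    obtain ⟨k, h | h⟩ := exists_lift_of_mem_closure hL hρ hτ (inv_mem hσ)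
    · convert comap_add_mem_cyclicNC hS' (2 * k) using 1
      ext i j
      simp only [Setoid.comap_rel, perm_smul_iff, h]
    · convert comap_sub_mem_cyclicNC hS' (2 * k - 1) using 1
      ext i j
      simp only [Setoid.comap_rel, perm_smul_iff, h]
  obtain ⟨T, hT, h⟩ := (bijOn_comap_circleProj hL).surjOn key
  convert hT
  ext x y
  rw [← circleProj_coe hL x, ← circleProj_coe hL y, ← Setoid.comap_rel (circleProj hL), ← h,
    Setoid.comap_rel]

theorem mem_closure_iff (hn : 0 < n) {ρ τ : Equiv.Perm (Fin (2 * n))}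
    (hρ : ∀ i : Fin (2 * n), (ρ i : ℕ) = ((i : ℕ) + 2) % (2 * n))
    (hτ : ∀ i : Fin (2 * n), (τ i : ℕ) = 2 * n - 1 - (i : ℕ)) (σ : Equiv.Perm (Fin (2 * n))) :
    σ ∈ (range n).image (ρ ^ ·) ∪ (range n).image (ρ ^ · * τ) ↔
      σ ∈ Subgroup.closure {ρ, τ} := by
  have hL : 0 < 2 * n := by omega
  have hρH : ρ ∈ Subgroup.closure {ρ, τ} := Subgroup.subset_closure (by simp)
  have hτH : τ ∈ Subgroup.closure {ρ, τ} := Subgroup.subset_closure (by simp)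
  simp only [mem_union, mem_image, mem_range]
  constructor
  · rintro (⟨k, -, rfl⟩ | ⟨k, -, rfl⟩)
    · exact pow_mem hρH k
    · exact mul_mem (pow_mem hρH k) hτH
  · intro hσ
    obtain ⟨k, h⟩ := exists_lift_of_mem_closure hL hρ hτ hσ
    have h1 := Int.emod_nonneg k (show (n : ℤ) ≠ 0 by omega)
    have h2 := Int.emod_lt_of_pos k (show (0 : ℤ) < n by omega)
    have e := Int.emod_add_mul_ediv k n
    have e1 : (((k % n).toNat : ℕ) : ℤ) = k % n := Int.toNat_of_nonneg h1
    have e2 : 2 * k = 2 * (k % n) + (2 * n : ℕ) * (k / n) := by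
      push_cast; rw [mul_assoc]; linarith
    refine h.imp (fun h => ⟨(k % n).toNat, by omega, ?_⟩) (fun h => ⟨(k % n).toNat, by omega, ?_⟩)
    · ext x : 1
      obtain ⟨i, rfl⟩ := circleProj_surjective hL x
      rw [lift_rotate_pow hL hρ, h, circleProj_eq_iff, e1, e2, ← add_assoc,
        Int.add_mul_emod_self_left]
    · ext x : 1
      obtain ⟨i, rfl⟩ := circleProj_surjective hL x
      rw [lift_rotate_pow_mul_reflect hL hρ hτ, h, circleProj_eq_iff, e1, e2,
        show 2 * (k % n) + (2 * n : ℕ) * (k / n) - 1 - i =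
          2 * (k % n) - 1 - i + (2 * n : ℕ) * (k / n) by ring, Int.add_mul_emod_self_left]

theorem sum_closure (hn : 0 < n) {ρ τ : Equiv.Perm (Fin (2 * n))}
    (hρ : ∀ i : Fin (2 * n), (ρ i : ℕ) = ((i : ℕ) + 2) % (2 * n))
    (hτ : ∀ i : Fin (2 * n), (τ i : ℕ) = 2 * n - 1 - (i : ℕ))
    [Fintype (Subgroup.closure {ρ, τ})] (F : Equiv.Perm (Fin (2 * n)) → ℕ) :
    ∑ σ : Subgroup.closure {ρ, τ}, F σ =
      ∑ k ∈ range n, F (ρ ^ k) + ∑ k ∈ range n, F (ρ ^ k * τ) := by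
  have hL : 0 < 2 * n := by omega
  rw [← Finset.sum_subtype _ (mem_closure_iff hn hρ hτ) F]
  have hinj : Set.InjOn (ρ ^ ·) (range n : Set ℕ) := by
    intro k hk l hl h
    rw [Finset.mem_coe, mem_range] at hk hl
    have := DFunLike.congr_fun h (circleProj hL 0)
    rw [lift_rotate_pow hL hρ, lift_rotate_pow hL hρ, circleProj_eq_iff,
      Int.emod_eq_of_lt (by omega) (by omega), Int.emod_eq_of_lt (by omega) (by omega)] at this
    omega
  rw [sum_union, sum_image hinj, sum_image fun k hk l hl h => hinj hk hl (mul_right_cancel h)]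
  rw [disjoint_left]
  simp only [mem_image, mem_range, not_exists, not_and]
  rintro _ ⟨k, hk, rfl⟩ l hl h
  have := DFunLike.congr_fun h (circleProj hL 0)
  rw [lift_rotate_pow hL hρ, lift_rotate_pow_mul_reflect hL hρ hτ, circleProj_eq_iff] at this
  have h2 := congrArg (· % (2 : ℤ)) this
  rw [Int.emod_emod_of_dvd _ (by simp), Int.emod_emod_of_dvd _ (by simp)] at h2
  omega

theorem card_closure (hn : 0 < n) {ρ τ : Equiv.Perm (Fin (2 * n))}
    (hρ : ∀ i : Fin (2 * n), (ρ i : ℕ) = ((i : ℕ) + 2) % (2 * n))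
    (hτ : ∀ i : Fin (2 * n), (τ i : ℕ) = 2 * n - 1 - (i : ℕ))
    [Fintype (Subgroup.closure {ρ, τ})] : Fintype.card (Subgroup.closure {ρ, τ}) = 2 * n := by
  have := sum_closure hn hρ hτ fun _ => 1
  simpa [two_mul] using this

end Group

theorem sum_gcd_eq_sum_divisors {n : ℕ} (hn : 0 < n) (f : ℕ → ℕ) :
    ∑ k ∈ range n, f (n.gcd k) = ∑ d ∈ n.divisors, (n / d).totient * f d := by
  rw [← sum_fiberwise_of_maps_to (t := n.divisors) (g := fun k => n.gcd k)
    (fun k _ => Nat.mem_divisors.2 ⟨n.gcd_dvd_left k, hn.ne'⟩)]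
  refine sum_congr rfl fun d hd => ?_
  rw [Nat.totient_div_of_dvd (Nat.dvd_of_mem_divisors hd), ← smul_eq_mul, ← sum_const]
  exact sum_congr rfl fun k hk => by rw [(mem_filter.1 hk).2]

theorem filter_not_pos_range {n : ℕ} (hn : 0 < n) : {k ∈ range n | ¬ 0 < k} = {0} := by
  ext k
  simp only [mem_filter, mem_range, mem_singleton]
  omega

theorem sum_range_gcd_choose {n : ℕ} (hn : 0 < n) :
    ∑ k ∈ range n with 0 < k, (2 * (2 * n.gcd k)).choose (2 * n.gcd k) =
      ∑ d ∈ (2 * n).divisors with Even d ∧ d < 2 * n,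
        (2 * n / d).totient * (2 * d).choose d := by
  have h := sum_gcd_eq_sum_divisors hn fun d => (2 * (2 * d)).choose (2 * d)
  rw [← sum_filter_add_sum_filter_not (range n) (0 < ·),
    ← sum_filter_add_sum_filter_not n.divisors (· < n)] at h
  have h2 : {d ∈ n.divisors | ¬ d < n} = {n} := by
    ext d
    simp only [mem_filter, Nat.mem_divisors, mem_singleton, not_lt]
    exact ⟨fun h => (Nat.le_of_dvd hn h.1.1).antisymm h.2, by rintro rfl; simp [hn.ne']⟩
  rw [filter_not_pos_range hn, h2, sum_singleton, sum_singleton, Nat.gcd_zero_right,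
    Nat.div_self hn, Nat.totient_one, one_mul, add_left_inj] at h
  rw [h]
  have h3 : {d ∈ (2 * n).divisors | Even d ∧ d < 2 * n} =
      {d ∈ n.divisors | d < n}.image (2 * ·) := by
    ext d
    simp only [mem_filter, Nat.mem_divisors, mem_image]
    constructor
    · rintro ⟨⟨h1, -⟩, h2, h3⟩
      obtain ⟨e, rfl⟩ := h2.two_dvd
      exact ⟨e, ⟨⟨Nat.dvd_of_mul_dvd_mul_left two_pos h1, hn.ne'⟩, by omega⟩, rfl⟩
    · rintro ⟨e, ⟨⟨h1, -⟩, h2⟩, rfl⟩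
      exact ⟨⟨Nat.mul_dvd_mul_left 2 h1, by omega⟩, even_two_mul e, by omega⟩
  rw [h3, sum_image fun a _ b _ h => Nat.eq_of_mul_eq_mul_left two_pos h]
  exact sum_congr rfl fun d _ => by rw [Nat.mul_div_mul_left _ _ two_pos]

theorem ncard_orbitSet_mul {n : ℕ} (hn : 0 < n) {ρ τ : Equiv.Perm (Fin (2 * n))}
    (hρ : ∀ i : Fin (2 * n), (ρ i : ℕ) = ((i : ℕ) + 2) % (2 * n))
    (hτ : ∀ i : Fin (2 * n), (τ i : ℕ) = 2 * n - 1 - (i : ℕ)) :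
    (orbitSet (Subgroup.closure {ρ, τ}) '' {P | NonCrossing P}).ncard * (2 * n) =
      (cyclicNC (2 * n : ℕ)).ncard + ∑ d ∈ (2 * n).divisors with Even d ∧ d < 2 * n,
        (2 * n / d).totient * (2 * d).choose d + n * (2 * n).choose n := by
  have hL : 0 < 2 * n := by omega
  let : Fintype (Subgroup.closure {ρ, τ}) := Fintype.ofFinite _
  have : Finite (Setoid (Fin (2 * n))) := Finite.of_surjective _ blockRel_bijective.2
  have hB := ncard_orbit_image_mul_card (G := Subgroup.closure {ρ, τ}) (s := finNC (2 * n))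
    fun σ S hS => smul_mem_finNC hL hρ hτ σ.2 hS
  rw [card_closure hn hρ hτ] at hB
  rw [ncard_orbitSet_image, image_blockRel_nonCrossing, hB]
  refine (sum_closure hn hρ hτ fun σ => {S ∈ finNC (2 * n) | σ • S = S}.ncard).trans ?_
  congr 1
  · rw [← sum_filter_add_sum_filter_not (range n) (0 < ·), add_comm,
      filter_not_pos_range hn, sum_singleton,
      ← sum_range_gcd_choose hn]
    congr 1
    · rw [ncard_finNC_fixed hL (lift_rotate_pow hL hρ 0)]
      simp
    · refine sum_congr rfl fun k hk => ?_
      rw [mem_filter, mem_range] at hk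
      rw [ncard_finNC_fixed hL (lift_rotate_pow hL hρ k), ncard_cyclicNC_rotate hk.2 hk.1]
  · have : ∀ k ∈ range n, {S ∈ finNC (2 * n) | (ρ ^ k * τ) • S = S}.ncard = (2 * n).choose n :=
      fun k _ => by
        rw [ncard_finNC_fixed hL (lift_rotate_pow_mul_reflect hL hρ hτ k),
          ncard_cyclicNC_reflect_sub hL (even_two_mul n), Nat.mul_div_cancel_left _ two_pos]
    rw [sum_congr rfl this, sum_const, card_range, smul_eq_mul]

end NoncrossingOrbits

/-- Theorem 3 of the paper: for even `L > 0`, the number `N_L` of orbits of non-crossing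
partitions of `{1,…,L}` under the group generated by the rotation `ρ₂(i) = i+2 (mod L)`
and the reflection `τ(i) = L+1−i` equals
`(1/2)·binom(L, L/2) + (1/L)·[C_L + Σ_{d even, d|L, 1 ≤ d < L} φ(L/d)·binom(2d, d)]`.
(Elements of `{1,…,L}` are modeled by `Fin L` with `m` corresponding to value `m−1`;
`ρ₂` and `τ` are specified by their action on values.) -/
theorem noncrossing_orbits_rotation_reflection (L : ℕ) (hL : 0 < L) (hE : Even L)
    (ρ₂ τ : Equiv.Perm (Fin L))
    (hρ : ∀ i : Fin L, ((ρ₂ i : ℕ)) = ((i : ℕ) + 2) % L)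
    (hτ : ∀ i : Fin L, ((τ i : ℕ)) = L - 1 - (i : ℕ)) :
    (((orbitSet (Subgroup.closure {ρ₂, τ})) '' {P | NonCrossing P}).ncard : ℚ)
      = (1 / 2) * Nat.choose L (L / 2)
        + (1 / L) * ((1 / (L + 1)) * Nat.choose (2 * L) L
          + ∑ d ∈ L.divisors.filter (fun d => Even d ∧ d < L),
              (Nat.totient (L / d)) * Nat.choose (2 * d) d) := by
  obtain ⟨n, rfl⟩ := hE.two_dvd
  have hn : 0 < n := by omega
  have h := NoncrossingOrbits.ncard_orbitSet_mul hn hρ hτ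
  rw [← NoncrossingOrbits.ncard_cyclicNC hL, Nat.mul_div_cancel_left _ two_pos]
  have h' := congrArg (Nat.cast (R := ℚ)) h
  push_cast at h' ⊢
  have hn' : (n : ℚ) ≠ 0 := by exact_mod_cast hn.ne'
  field_simp
  linarith
end
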